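/- arXiv:2106.13796 — 5 statements merged into one kernel-verified Lean document; each statement's English description precedes it below -/
import Mathlib

section
/- Let a, b, c, n be positive integers with gcd(a,b) = gcd(b,c) = gcd(c,a) = 1. Let b'_1 be the unique integer with 1 ≤ b'_1 ≤ a and b·b'_1 ≡ −n (mod a), and c'_1 the unique integer with 1 ≤ c'_1 ≤ a and c·c'_1 ≡ b (mod a). Let c'_2 be the unique integer with 1 ≤ c'_2 ≤ b and c·c'_2 ≡ −n (mod b), and a'_2 the unique integer with 1 ≤ a'_2 ≤ b and a·a'_2 ≡ c (mod b). Let a'_3 be the unique integer with 1 ≤ a'_3 ≤ c and a·a'_3 ≡ −n (mod c), and b'_3 the unique integer with 1 ≤ b'_3 ≤ c and b·b'_3 ≡ a (mod c). Let N_1 = n(n + a + b + c) + c·b·b'_1(a + 1 − c'_1(b'_1 − 1)) + a·c·c'_2(b + 1 − a'_2(c'_2 − 1)) + b·a·a'_3(c + 1 − b'_3(a'_3 − 1)). Then N(a,b,c;n) = N_1/(2abc) + Σ_{i=1}^{b'_1−1} ⌊i·c'_1/a⌋ + Σ_{i=1}^{c'_2−1} ⌊i·a'_2/b⌋ + Σ_{i=1}^{a'_3−1}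 ⌊i·b'_3/c⌋ − 2. -/
/-- `numSol a b c n` is the number of triples `(x, y, z)` of nonnegative integers
satisfying `a*x + b*y + c*z = n`. -/
noncomputable def numSol (a b c n : ℕ) : ℕ :=
  {p : ℕ × ℕ × ℕ | a * p.1 + b * p.2.1 + c * p.2.2 = n}.ncard

/-- The representative of `x / a` modulo `1` lying in the interval `(0, 1]`. -/
def upperFract (a x : ℕ) : ℚ := if a ∣ x then 1 else ((x % a : ℕ) : ℚ) / a

lemma upperFract_congr {a x y : ℕ} (h : x ≡ y [MOD a]) : upperFract a x = upperFract a y := by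
  have hd : a ∣ x ↔ a ∣ y := h.dvd_iff dvd_rfl
  have hm : x % a = y % a := h
  simp [upperFract, hd, hm]

lemma upperFract_zero (a : ℕ) : upperFract a 0 = 1 := by simp [upperFract]

lemma upperFract_succ {a : ℕ} (ha : 0 < a) (x : ℕ) :
    upperFract a (x + 1) = upperFract a x + 1 / a - if a ∣ x then 1 else 0 := by
  have ha' : (a : ℚ) ≠ 0 := by positivity
  have hx : x % a < a := Nat.mod_lt _ ha
  rw [upperFract_congr (Nat.ModEq.add_right 1 (Nat.mod_modEq x a)).symm,
    upperFract_congr (Nat.mod_modEq x a).symm]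
  have hd : a ∣ x ↔ x % a = 0 := Nat.dvd_iff_mod_eq_zero
  simp only [hd]
  generalize x % a = r at hx
  by_cases hr : r + 1 = a
  · rcases Nat.eq_zero_or_pos r with h0 | h0
    · subst h0
      have : a = 1 := by omega
      subst this
      simp [upperFract]
    · have h1 : ¬ a ∣ r := fun h => by have := Nat.le_of_dvd h0 h; omega
      have h2 : a ∣ r + 1 := by rw [hr]
      have h3 : (r : ℚ) + 1 = a := by exact_mod_cast hr
      simp only [upperFract, h1, h2, if_true, if_false, h0.ne', Nat.mod_eq_of_lt hx]
      rw [← h3] at ha' ⊢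
      field_simp
      ring
  · have h2 : ¬ a ∣ r + 1 := fun h => by have := Nat.le_of_dvd (by omega) h; omega
    have h3 : (r + 1) % a = r + 1 := Nat.mod_eq_of_lt (by omega)
    rcases Nat.eq_zero_or_pos r with h0 | h0
    · subst h0
      simp [upperFract, show a ≠ 1 by omega, Nat.mod_eq_of_lt (show 1 < a by omega)]
    · have h1 : ¬ a ∣ r := fun h => by have := Nat.le_of_dvd h0 h; omega
      simp only [upperFract, h1, h2, if_false, h0.ne', Nat.mod_eq_of_lt hx, h3]
      push_cast
      ring

lemma sum_upperFract {a : ℕ} (ha : 0 < a) :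
    ∑ j ∈ Finset.range a, upperFract a j = ((a : ℚ) + 1) / 2 := by
  have ha' : (a : ℚ) ≠ 0 := by positivity
  have key : ∀ m, m + 1 ≤ a → ∑ j ∈ Finset.range (m + 1), upperFract a j
      = 1 + (m : ℚ) * (m + 1) / (2 * a) := by
    intro m
    induction m with
    | zero => intro _; simp [upperFract_zero]
    | succ m ih =>
      intro hm
      have h1 : ¬ a ∣ m + 1 := fun h => by have := Nat.le_of_dvd (by omega) h; omega
      rw [Finset.sum_range_succ, ih (by omega)]
      simp only [upperFract, h1, if_false, Nat.mod_eq_of_lt (show m + 1 < a by omega)]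
      push_cast
      field_simp
      ring
  obtain ⟨m, rfl⟩ : ∃ m, a = m + 1 := ⟨a - 1, by omega⟩
  rw [key m le_rfl]
  push_cast at ha' ⊢
  field_simp
  ring

lemma sum_upperFract_mul {a u k : ℕ} (ha : 0 < a) (hk : u * k ≡ 1 [MOD a]) :
    ∑ j ∈ Finset.range a, upperFract a (j * u) = ((a : ℚ) + 1) / 2 := by
  rw [← sum_upperFract ha]
  have inv : ∀ {u k : ℕ}, u * k ≡ 1 [MOD a] → ∀ j ∈ Finset.range a, j * u % a * k % a = j := by
    intro u k hk j hj
    have h : j * u % a * k ≡ j [MOD a] :=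
      calc j * u % a * k ≡ j * u * k [MOD a] := (Nat.mod_modEq _ _).mul_right _
        _ = j * (u * k) := by ring
        _ ≡ j * 1 [MOD a] := hk.mul_left _
        _ = j := by ring
    exact Eq.trans h (Nat.mod_eq_of_lt (Finset.mem_range.1 hj))
  refine Finset.sum_nbij' (fun j => j * u % a) (fun j => j * k % a) ?_ ?_ (inv hk)
    (inv (by rwa [mul_comm])) ?_
  · intro j _; exact Finset.mem_range.2 (Nat.mod_lt _ ha)
  · intro j _; exact Finset.mem_range.2 (Nat.mod_lt _ ha)
  · intro j _; exact upperFract_congr (Nat.mod_modEq _ _).symm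

/-- Partial sums of the centred sawtooth `i ↦ (a + 1) / (2 * a) - upperFract a (i * u)`,
normalised to be `1` at `0`. -/
def sawtoothSum (a u j : ℕ) : ℚ :=
  1 + ∑ i ∈ Finset.range j, (((a : ℚ) + 1) / (2 * a) - upperFract a (i * u))

lemma sawtoothSum_succ (a u j : ℕ) :
    sawtoothSum a u (j + 1)
      = sawtoothSum a u j + (((a : ℚ) + 1) / (2 * a) - upperFract a (j * u)) := by
  rw [sawtoothSum, Finset.sum_range_succ, sawtoothSum, add_assoc]

lemma sawtoothSum_add_self {a u k : ℕ} (ha : 0 < a) (hk : u * k ≡ 1 [MOD a]) (j : ℕ) :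
    sawtoothSum a u (j + a) = sawtoothSum a u j := by
  have ha' : (a : ℚ) ≠ 0 := by positivity
  induction j with
  | zero =>
    simp only [sawtoothSum, zero_add, Finset.sum_sub_distrib, sum_upperFract_mul ha hk]
    simp
    field_simp
    ring
  | succ j ih =>
    have h : (j + a) * u ≡ j * u [MOD a] := by
      simp [Nat.ModEq, add_mul]
    rw [show j + 1 + a = j + a + 1 by ring, sawtoothSum_succ, ih, sawtoothSum_succ,
      upperFract_congr h]

lemma sawtoothSum_congr {a u k : ℕ} (ha : 0 < a) (hk : u * k ≡ 1 [MOD a]) {i j : ℕ}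
    (h : i ≡ j [MOD a]) : sawtoothSum a u i = sawtoothSum a u j := by
  have hp : Function.Periodic (sawtoothSum a u) a := sawtoothSum_add_self ha hk
  rw [← hp.map_mod_nat i, ← hp.map_mod_nat j, h]

lemma sum_range_shift_of_periodic {a : ℕ} {f : ℕ → ℚ} (hf : Function.Periodic f a) (k : ℕ) :
    ∑ j ∈ Finset.range a, f (j + k) = ∑ j ∈ Finset.range a, f j := by
  induction k with
  | zero => simp
  | succ k ih =>
    rw [← ih]
    have h1 := Finset.sum_range_succ (fun j => f (j + k)) a
    have h2 := Finset.sum_range_succ' (fun j => f (j + k)) a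
    have h3 : f (a + k) = f (0 + k) := by rw [add_comm a k, hf k, zero_add]
    have h4 : ∀ j, j + 1 + k = j + (k + 1) := fun j => by ring
    simp only [h4] at h2
    linarith

lemma sawtoothSum_add_inv {a u k : ℕ} (ha : 0 < a) (hk : u * k ≡ 1 [MOD a]) (j : ℕ) :
    sawtoothSum a u (j + k)
      = sawtoothSum a u j + (((a : ℚ) + 1) / (2 * a) - upperFract a j) := by
  have ha' : (a : ℚ) ≠ 0 := by positivity
  let X : ℕ → ℚ := fun j => sawtoothSum a u (j + k) - sawtoothSum a u j
    - ((a : ℚ) + 1) / (2 * a) + upperFract a j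
  have hu : Nat.Coprime a u := by
    refine Nat.Coprime.symm (Nat.Coprime.coprime_mul_right (k := k) ?_)
    rw [Nat.Coprime, hk.gcd_eq]
    simp
  have hstep : ∀ j, X (j + 1) = X j := by
    intro j
    have h1 : (j + k) * u ≡ j * u + 1 [MOD a] := by
      rw [add_mul, mul_comm k u]
      exact hk.add_left _
    have h2 : a ∣ j * u ↔ a ∣ j := hu.dvd_mul_right
    simp only [X]
    rw [show j + 1 + k = j + k + 1 by ring, sawtoothSum_succ, sawtoothSum_succ,
      upperFract_congr h1, upperFract_succ ha, upperFract_succ ha]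
    simp only [h2]
    ring
  have hconst : ∀ j, X j = X 0 := by
    intro j
    induction j with
    | zero => rfl
    | succ j ih => rw [hstep, ih]
  have hsum : ∑ j ∈ Finset.range a, X j = 0 := by
    simp only [X, Finset.sum_add_distrib, Finset.sum_sub_distrib, sum_upperFract ha,
      sum_range_shift_of_periodic (f := sawtoothSum a u) (sawtoothSum_add_self ha hk) k]
    simp
    field_simp
    ring
  simp only [hconst] at hsum
  have h0 : X 0 = 0 := by simpa [ha.ne'] using hsum
  have := (hconst j).trans h0
  simp only [X] at this
  linarith

lemma exists_dvd_mul_add {a b : ℕ} (ha : 0 < a) (hab : Nat.Coprime a b) (n : ℕ) :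
    ∃ j, a ∣ b * j + n := by
  have hn : n ≤ a * n := Nat.le_mul_of_pos_left n ha
  obtain ⟨m, hm⟩ := Nat.exists_mul_mod_eq_of_coprime (n := b) (k := a) (a * n - n) hab.symm ha.ne'
  refine ⟨m, ?_⟩
  have h : b * m + n ≡ a * n - n + n [MOD a] := Nat.ModEq.add_right n hm.2
  rw [Nat.sub_add_cancel hn] at h
  exact (h.dvd_iff dvd_rfl).2 (dvd_mul_right a n)

lemma modEq_of_dvd_mul_add {a b x y m : ℕ} (hab : Nat.Coprime a b)
    (hx : a ∣ b * x + m) (hy : a ∣ b * y + m) : x ≡ y [MOD a] := by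
  have h : b * x + m ≡ b * y + m [MOD a] :=
    (Nat.modEq_zero_iff_dvd.2 hx).trans (Nat.modEq_zero_iff_dvd.2 hy).symm
  exact Nat.ModEq.cancel_left_of_coprime hab (Nat.ModEq.add_right_cancel' m h)

open Classical in
/-- A natural number `j` with `b * j ≡ -n` modulo `a`, if there is one. -/
noncomputable def negQuot (a b n : ℕ) : ℕ :=
  if h : ∃ j, a ∣ b * j + n then h.choose else 0

lemma dvd_negQuot {a b : ℕ} (ha : 0 < a) (hab : Nat.Coprime a b) (n : ℕ) :
    a ∣ b * negQuot a b n + n := by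
  have h := exists_dvd_mul_add ha hab n
  rw [negQuot, dif_pos h]
  exact h.choose_spec

lemma negQuot_modEq {a b n j : ℕ} (ha : 0 < a) (hab : Nat.Coprime a b) (hj : a ∣ b * j + n) :
    negQuot a b n ≡ j [MOD a] :=
  modEq_of_dvd_mul_add hab (dvd_negQuot ha hab n) hj

lemma negQuot_add_self {a b : ℕ} (ha : 0 < a) (hab : Nat.Coprime a b) (n : ℕ) :
    negQuot a b (n + a) ≡ negQuot a b n [MOD a] := by
  refine negQuot_modEq ha hab ?_
  rw [← add_assoc]
  exact dvd_add (dvd_negQuot ha hab n) dvd_rfl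

lemma negQuot_modEq_succ {a b : ℕ} (ha : 0 < a) (hab : Nat.Coprime a b) (n : ℕ) :
    negQuot a b n ≡ negQuot a b (n + b) + 1 [MOD a] := by
  refine negQuot_modEq ha hab ?_
  have := dvd_negQuot ha hab (n + b)
  rwa [show b * (negQuot a b (n + b) + 1) + n = b * negQuot a b (n + b) + (n + b) by ring]

lemma exists_mul_modEq {a b : ℕ} (ha : 0 < a) (hab : Nat.Coprime a b) (c : ℕ) :
    ∃ k, b * k ≡ c [MOD a] := by
  obtain ⟨m, hm⟩ := Nat.exists_mul_mod_eq_of_coprime (n := b) (k := a) c hab.symm ha.ne'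
  exact ⟨m, hm.2⟩

lemma exists_inverse {a b c u : ℕ} (ha : 0 < a) (hab : Nat.Coprime a b) (hac : Nat.Coprime a c)
    (hu : c * u ≡ b [MOD a]) : ∃ k, b * k ≡ c [MOD a] ∧ u * k ≡ 1 [MOD a] := by
  obtain ⟨k, hk⟩ := exists_mul_modEq ha hab c
  refine ⟨k, hk, Nat.ModEq.cancel_left_of_coprime (c := c) hac ?_⟩
  rw [← mul_assoc, mul_one]
  exact (hu.mul_right k).trans hk

/-- The contribution of the modulus `a` to the number of solutions of `a x + b y + c z = n`,
where `c * u ≡ b` modulo `a`. -/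
noncomputable def periodicPart (a b u n : ℕ) : ℚ := sawtoothSum a u (negQuot a b n)

section periodicPart

variable {a b c u : ℕ} (ha : 0 < a) (hab : Nat.Coprime a b) (hac : Nat.Coprime a c)
  (hu : c * u ≡ b [MOD a]) (n : ℕ)

include ha hab hac hu

lemma periodicPart_add_self : periodicPart a b u (n + a) = periodicPart a b u n := by
  obtain ⟨k, -, hk⟩ := exists_inverse ha hab hac hu
  exact sawtoothSum_congr ha hk (negQuot_add_self ha hab n)

lemma periodicPart_add_left : periodicPart a b u n = periodicPart a b u (n + b)
    + (((a : ℚ) + 1) / (2 * a) - upperFract a (negQuot a c (n + b))) := by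
  obtain ⟨k, -, hk⟩ := exists_inverse ha hab hac hu
  have h : negQuot a c (n + b) ≡ negQuot a b (n + b) * u [MOD a] := by
    refine negQuot_modEq ha hac ?_
    have h1 : c * (negQuot a b (n + b) * u) + (n + b)
        ≡ b * negQuot a b (n + b) + (n + b) [MOD a] := by
      rw [show c * (negQuot a b (n + b) * u) = c * u * negQuot a b (n + b) by ring]
      exact (hu.mul_right _).add_right _
    exact (h1.dvd_iff dvd_rfl).2 (dvd_negQuot ha hab _)
  rw [upperFract_congr h, periodicPart, sawtoothSum_congr ha hk (negQuot_modEq_succ ha hab n),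
    sawtoothSum_succ, periodicPart]

lemma periodicPart_add_right : periodicPart a b u n = periodicPart a b u (n + c)
    + (((a : ℚ) + 1) / (2 * a) - upperFract a (negQuot a b (n + c))) := by
  obtain ⟨k, hbk, hk⟩ := exists_inverse ha hab hac hu
  have h : negQuot a b n ≡ negQuot a b (n + c) + k [MOD a] := by
    refine negQuot_modEq ha hab ?_
    have h1 : b * (negQuot a b (n + c) + k) + n ≡ b * negQuot a b (n + c) + (n + c) [MOD a] := by
      rw [show b * (negQuot a b (n + c) + k) + n = b * negQuot a b (n + c) + n + b * k by ring,
        ← add_assoc]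
      exact hbk.add_left _
    exact (h1.dvd_iff dvd_rfl).2 (dvd_negQuot ha hab _)
  rw [periodicPart, sawtoothSum_congr ha hk h, sawtoothSum_add_inv ha hk, periodicPart]

lemma periodicPart_zero : periodicPart a b u 0 = 1 := by
  obtain ⟨k, -, hk⟩ := exists_inverse ha hab hac hu
  rw [periodicPart, sawtoothSum_congr ha hk (negQuot_modEq ha hab (j := 0) (by simp))]
  simp [sawtoothSum]

lemma periodicPart_eq_sum_floor {j : ℕ} (hj1 : 1 ≤ j) (hja : j ≤ a) (hj : a ∣ b * j + n) :
    periodicPart a b u n = (j : ℚ) * ((a : ℚ) + 1 - u * ((j : ℚ) - 1)) / (2 * a)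
      + ∑ i ∈ Finset.Icc 1 (j - 1), (⌊((i : ℚ) * u / a)⌋ : ℚ) := by
  have ha' : (a : ℚ) ≠ 0 := by positivity
  obtain ⟨k, -, hk⟩ := exists_inverse ha hab hac hu
  have hau : Nat.Coprime a u := by
    refine Nat.Coprime.symm (Nat.Coprime.coprime_mul_right (k := k) ?_)
    rw [Nat.Coprime, hk.gcd_eq]
    simp
  rw [periodicPart, sawtoothSum_congr ha hk (negQuot_modEq ha hab hj)]
  clear hj
  obtain ⟨m, rfl⟩ : ∃ m, j = m + 1 := ⟨j - 1, by omega⟩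
  rw [Nat.add_sub_cancel]
  clear hj1
  induction m with
  | zero =>
    simp [sawtoothSum, upperFract_zero]
  | succ m ih =>
    have hd : ¬ a ∣ (m + 1) * u := by
      rw [hau.dvd_mul_right]
      intro h
      have := Nat.le_of_dvd (by omega) h
      omega
    have hfl : (⌊(((m + 1 : ℕ) : ℚ) * u / a)⌋ : ℚ) = (((m + 1) * u / a : ℕ) : ℚ) := by
      rw [← Nat.cast_mul, Rat.floor_natCast_div_natCast]
      norm_cast
    have hdm : (a : ℚ) * (((m + 1) * u / a : ℕ) : ℚ) + (((m + 1) * u % a : ℕ) : ℚ)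
        = ((m : ℚ) + 1) * u := by
      exact_mod_cast Nat.div_add_mod ((m + 1) * u) a
    have hr : (((m + 1) * u % a : ℕ) : ℚ)
        = ((m : ℚ) + 1) * u - (a : ℚ) * (((m + 1) * u / a : ℕ) : ℚ) := by linarith
    rw [sawtoothSum_succ, ih (by omega), Finset.sum_Icc_succ_top (by omega), hfl]
    simp only [upperFract, hd, if_false, hr]
    push_cast
    field_simp
    ring

end periodicPart

lemma eq_zero_value_of_periodic {a b : ℕ} (ha : 0 < a) (hab : Nat.Coprime a b) {f : ℕ → ℚ}
    (hfa : Function.Periodic f a) (hfb : Function.Periodic f b) (n : ℕ) : f n = f 0 := by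
  obtain ⟨j, y, hy⟩ := exists_dvd_mul_add ha hab n
  have h1 := (hfb.nat_mul j) n
  have h2 := (hfa.nat_mul y) 0
  simp only [Nat.cast_id] at h1 h2
  rw [← h1, ← h2, zero_add, mul_comm y a, ← hy, mul_comm b j, add_comm]

/-- The number of pairs `(x, y)` of natural numbers with `a * x + b * y = n`. -/
noncomputable def numSolPair (a b n : ℕ) : ℕ := {p : ℕ × ℕ | a * p.1 + b * p.2 = n}.ncard

lemma finite_numSolPair {a b : ℕ} (ha : 0 < a) (hb : 0 < b) (n : ℕ) :
    {p : ℕ × ℕ | a * p.1 + b * p.2 = n}.Finite := by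
  refine (Set.finite_Iic ((n, n) : ℕ × ℕ)).subset ?_
  rintro ⟨x, y⟩ h
  simp only [Set.mem_ofPred_eq] at h
  exact ⟨by dsimp only; nlinarith, by dsimp only; nlinarith⟩

lemma finite_numSol {a b c : ℕ} (ha : 0 < a) (hb : 0 < b) (hc : 0 < c) (n : ℕ) :
    {p : ℕ × ℕ × ℕ | a * p.1 + b * p.2.1 + c * p.2.2 = n}.Finite := by
  refine (Set.finite_Iic ((n, n, n) : ℕ × ℕ × ℕ)).subset ?_
  rintro ⟨x, y, z⟩ h
  simp only [Set.mem_ofPred_eq] at h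
  exact ⟨by dsimp only; nlinarith, by dsimp only; nlinarith, by dsimp only; nlinarith⟩

lemma numSolPair_comm (a b n : ℕ) : numSolPair a b n = numSolPair b a n := by
  refine Set.ncard_congr (fun p _ => p.swap) ?_ ?_ ?_
  · rintro ⟨x, y⟩ h
    simpa [add_comm] using h
  · intro p q _ _ h
    exact Prod.swap_injective h
  · rintro ⟨x, y⟩ h
    exact ⟨(y, x), by simpa [add_comm] using h, rfl⟩

lemma numSol_rotate (a b c n : ℕ) : numSol a b c n = numSol b c a n := by
  refine Set.ncard_congr (fun p _ => (p.2.1, p.2.2, p.1)) ?_ ?_ ?_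
  · rintro ⟨x, y, z⟩ h
    simp only [Set.mem_ofPred_eq] at h ⊢
    linarith
  · rintro ⟨x, y, z⟩ ⟨x', y', z'⟩ _ _ h
    simp only [Prod.mk.injEq] at h ⊢
    tauto
  · rintro ⟨y, z, x⟩ h
    refine ⟨(x, y, z), ?_, rfl⟩
    simp only [Set.mem_ofPred_eq] at h ⊢
    linarith

lemma numSolPair_add {a b : ℕ} (ha : 0 < a) (hb : 0 < b) (n : ℕ) :
    numSolPair a b (n + b) = numSolPair a b n + if a ∣ n + b then 1 else 0 := by
  have hsplit : {p : ℕ × ℕ | a * p.1 + b * p.2 = n + b}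
      = (fun p : ℕ × ℕ => (p.1, p.2 + 1)) '' {p : ℕ × ℕ | a * p.1 + b * p.2 = n}
        ∪ (fun x => (x, 0)) '' {x : ℕ | a * x = n + b} := by
    ext ⟨x, y⟩
    simp only [Set.mem_ofPred_eq, Set.mem_union, Set.mem_image, Prod.mk.injEq, Prod.exists]
    constructor
    · intro h
      rcases y with _ | y
      · exact Or.inr ⟨x, by simpa using h, rfl, rfl⟩
      · exact Or.inl ⟨x, y, by linarith, rfl, rfl⟩
    · rintro (⟨x, y, h, rfl, rfl⟩ | ⟨x, h, rfl, rfl⟩) <;> linarith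
  have hone : {x : ℕ | a * x = n + b}.ncard = if a ∣ n + b then 1 else 0 := by
    split_ifs with h
    · obtain ⟨x, hx⟩ := h
      rw [Set.ncard_eq_one]
      refine ⟨x, ?_⟩
      ext y
      simp [hx, ha.ne']
    · convert Set.ncard_empty ℕ
      ext y
      simp only [Set.mem_ofPred_eq, Set.mem_empty_iff_false, iff_false]
      exact fun hy => h ⟨y, hy.symm⟩
  have hfin : {x : ℕ | a * x = n + b}.Finite :=
    (Set.finite_Iic (n + b)).subset fun x (hx : a * x = n + b) => by
      simp only [Set.mem_Iic]
      nlinarith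
  rw [numSolPair, hsplit, Set.ncard_union_eq ?_ ((finite_numSolPair ha hb n).image _)
    (hfin.image _), Set.ncard_image_of_injective, Set.ncard_image_of_injective, hone, numSolPair]
  · intro x y h
    simpa using h
  · rintro ⟨x, y⟩ ⟨x', y'⟩ h
    simpa using h
  · rw [Set.disjoint_left]
    rintro _ ⟨p, _, rfl⟩ ⟨x, _, h⟩
    simp at h

lemma numSol_add {a b c : ℕ} (ha : 0 < a) (hb : 0 < b) (hc : 0 < c) (n : ℕ) :
    numSol a b c (n + c) = numSol a b c n + numSolPair a b (n + c) := by
  have hsplit : {p : ℕ × ℕ × ℕ | a * p.1 + b * p.2.1 + c * p.2.2 = n + c}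
      = (fun p : ℕ × ℕ × ℕ => (p.1, p.2.1, p.2.2 + 1)) ''
          {p : ℕ × ℕ × ℕ | a * p.1 + b * p.2.1 + c * p.2.2 = n}
        ∪ (fun p : ℕ × ℕ => (p.1, p.2, 0)) '' {p : ℕ × ℕ | a * p.1 + b * p.2 = n + c} := by
    ext ⟨x, y, z⟩
    simp only [Set.mem_ofPred_eq, Set.mem_union, Set.mem_image, Prod.mk.injEq, Prod.exists]
    constructor
    · intro h
      rcases z with _ | z
      · exact Or.inr ⟨x, y, by simpa using h, rfl, rfl, rfl⟩
      · exact Or.inl ⟨x, y, z, by linarith, rfl, rfl, rfl⟩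
    · rintro (⟨x, y, z, h, rfl, rfl, rfl⟩ | ⟨x, y, h, rfl, rfl, rfl⟩) <;> linarith
  rw [numSol, hsplit, Set.ncard_union_eq ?_ ((finite_numSol ha hb hc n).image _)
    ((finite_numSolPair ha hb _).image _), Set.ncard_image_of_injective,
    Set.ncard_image_of_injective, numSolPair, numSol]
  · rintro ⟨x, y⟩ ⟨x', y'⟩ h
    simpa using h
  · rintro ⟨x, y, z⟩ ⟨x', y', z'⟩ h
    simpa using h
  · rw [Set.disjoint_left]
    rintro _ ⟨p, _, rfl⟩ ⟨q, _, h⟩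
    simp at h

lemma numSolPair_zero {a b : ℕ} (ha : 0 < a) (hb : 0 < b) : numSolPair a b 0 = 1 := by
  rw [numSolPair, Set.ncard_eq_one]
  refine ⟨(0, 0), ?_⟩
  ext ⟨x, y⟩
  simp [ha.ne', hb.ne']

lemma numSol_zero {a b c : ℕ} (ha : 0 < a) (hb : 0 < b) (hc : 0 < c) : numSol a b c 0 = 1 := by
  rw [numSol, Set.ncard_eq_one]
  refine ⟨(0, 0, 0), ?_⟩
  ext ⟨x, y, z⟩
  simp [ha.ne', hb.ne', hc.ne', and_assoc]

/-- The right-hand side of Popoviciu's formula for `numSolPair a b n`. -/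
noncomputable def popoviciu (a b n : ℕ) : ℚ :=
  (n : ℚ) / (a * b) - 1 + upperFract a (negQuot a b n) + upperFract b (negQuot b a n)

lemma popoviciu_comm (a b n : ℕ) : popoviciu a b n = popoviciu b a n := by
  rw [popoviciu, popoviciu, mul_comm (a : ℚ)]
  ring

lemma popoviciu_add {a b : ℕ} (ha : 0 < a) (hb : 0 < b) (hab : Nat.Coprime a b) (n : ℕ) :
    popoviciu a b (n + b) = popoviciu a b n + if a ∣ n + b then 1 else 0 := by
  have ha' : (a : ℚ) ≠ 0 := by positivity
  have hb' : (b : ℚ) ≠ 0 := by positivity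
  have hd : a ∣ negQuot a b (n + b) ↔ a ∣ n + b := by
    rw [← hab.dvd_mul_left]
    have h := dvd_negQuot ha hab (n + b)
    exact ⟨fun h1 => (Nat.dvd_add_right h1).1 h, fun h1 => (Nat.dvd_add_left h1).1 h⟩
  rw [popoviciu, popoviciu, upperFract_congr (negQuot_add_self hb hab.symm n),
    upperFract_congr (negQuot_modEq_succ ha hab n), upperFract_succ ha]
  simp only [hd]
  push_cast
  field_simp
  ring

lemma numSolPair_eq_popoviciu {a b : ℕ} (ha : 0 < a) (hb : 0 < b) (hab : Nat.Coprime a b)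
    (n : ℕ) : (numSolPair a b n : ℚ) = popoviciu a b n := by
  have key : ∀ {a b : ℕ}, 0 < a → 0 < b → Nat.Coprime a b →
      Function.Periodic (fun n => (numSolPair a b n : ℚ) - popoviciu a b n) b := by
    intro a b ha hb hab n
    simp only [numSolPair_add ha hb, popoviciu_add ha hb hab]
    push_cast
    ring
  have hper : Function.Periodic (fun n => (numSolPair a b n : ℚ) - popoviciu a b n) a := by
    simpa only [numSolPair_comm a b, popoviciu_comm a b] using key hb ha hab.symm
  have h0 : popoviciu a b 0 = 1 := by
    rw [popoviciu, upperFract_congr (negQuot_modEq ha hab (j := 0) (by simp)),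
      upperFract_congr (negQuot_modEq hb hab.symm (j := 0) (by simp))]
    simp [upperFract_zero]
  have := eq_zero_value_of_periodic ha hab hper (key ha hb hab) n
  simp only [h0, numSolPair_zero ha hb] at this
  push_cast at this
  linarith

/-- The quasi-polynomial that counts the solutions of `a x + b y + c z = n`. -/
noncomputable def solQuasiPoly (a b c u v w n : ℕ) : ℚ :=
  (n : ℚ) * (n + a + b + c) / (2 * a * b * c) - 2
    + periodicPart a b u n + periodicPart b c v n + periodicPart c a w n

lemma solQuasiPoly_rotate (a b c u v w n : ℕ) :
    solQuasiPoly a b c u v w n = solQuasiPoly b c a v w u n := by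
  rw [solQuasiPoly, solQuasiPoly, show (2 * a * b * c : ℚ) = 2 * b * c * a by ring]
  ring

lemma solQuasiPoly_add {a b c u v w : ℕ} (ha : 0 < a) (hb : 0 < b) (hc : 0 < c)
    (hab : Nat.Coprime a b) (hbc : Nat.Coprime b c) (hca : Nat.Coprime c a)
    (hu : c * u ≡ b [MOD a]) (hv : a * v ≡ c [MOD b]) (hw : b * w ≡ a [MOD c]) (n : ℕ) :
    solQuasiPoly a b c u v w (n + c) = solQuasiPoly a b c u v w n + popoviciu a b (n + c) := by
  have ha' : (a : ℚ) ≠ 0 := by positivity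
  have hb' : (b : ℚ) ≠ 0 := by positivity
  have hc' : (c : ℚ) ≠ 0 := by positivity
  rw [solQuasiPoly, solQuasiPoly, periodicPart_add_self hc hca hbc.symm hw,
    periodicPart_add_right ha hab hca.symm hu n, periodicPart_add_left hb hbc hab.symm hv n,
    popoviciu]
  push_cast
  field_simp
  ring

lemma numSol_eq_solQuasiPoly {a b c u v w : ℕ} (ha : 0 < a) (hb : 0 < b) (hc : 0 < c)
    (hab : Nat.Coprime a b) (hbc : Nat.Coprime b c) (hca : Nat.Coprime c a)
    (hu : c * u ≡ b [MOD a]) (hv : a * v ≡ c [MOD b]) (hw : b * w ≡ a [MOD c]) (n : ℕ) :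
    (numSol a b c n : ℚ) = solQuasiPoly a b c u v w n := by
  have key : ∀ {a b c u v w : ℕ}, 0 < a → 0 < b → 0 < c →
      Nat.Coprime a b → Nat.Coprime b c → Nat.Coprime c a →
      c * u ≡ b [MOD a] → a * v ≡ c [MOD b] → b * w ≡ a [MOD c] →
      Function.Periodic (fun n => (numSol a b c n : ℚ) - solQuasiPoly a b c u v w n) c := by
    intro a b c u v w ha hb hc hab hbc hca hu hv hw n
    simp only [numSol_add ha hb hc, solQuasiPoly_add ha hb hc hab hbc hca hu hv hw]
    push_cast
    rw [numSolPair_eq_popoviciu ha hb hab]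
    ring
  have hper : Function.Periodic (fun n => (numSol a b c n : ℚ) - solQuasiPoly a b c u v w n) a := by
    simpa only [numSol_rotate a b c, solQuasiPoly_rotate a b c]
      using key hb hc ha hbc hca hab hv hw hu
  have h0 : solQuasiPoly a b c u v w 0 = 1 := by
    rw [solQuasiPoly, periodicPart_zero ha hab hca.symm hu, periodicPart_zero hb hbc hab.symm hv,
      periodicPart_zero hc hca hbc.symm hw]
    norm_num
  have := eq_zero_value_of_periodic ha hca.symm hper (key ha hb hc hab hbc hca hu hv hw) n
  simp only [h0, numSol_zero ha hb hc] at this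
  push_cast at this
  linarith

theorem stmt_0 (a b c n b1 c1 c2 a2 a3 b3 : ℕ)
    (ha : 0 < a) (hb : 0 < b) (hc : 0 < c) (hn : 0 < n)
    (hab : Nat.gcd a b = 1) (hbc : Nat.gcd b c = 1) (hca : Nat.gcd c a = 1)
    (hb1 : 1 ≤ b1 ∧ b1 ≤ a ∧ (a : ℤ) ∣ ((b : ℤ) * b1 + n))
    (hc1 : 1 ≤ c1 ∧ c1 ≤ a ∧ (a : ℤ) ∣ ((c : ℤ) * c1 - b))
    (hc2 : 1 ≤ c2 ∧ c2 ≤ b ∧ (b : ℤ) ∣ ((c : ℤ) * c2 + n))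
    (ha2 : 1 ≤ a2 ∧ a2 ≤ b ∧ (b : ℤ) ∣ ((a : ℤ) * a2 - c))
    (ha3 : 1 ≤ a3 ∧ a3 ≤ c ∧ (c : ℤ) ∣ ((a : ℤ) * a3 + n))
    (hb3 : 1 ≤ b3 ∧ b3 ≤ c ∧ (c : ℤ) ∣ ((b : ℤ) * b3 - a))
    (N1 : ℤ)
    (hN1 : N1 = (n : ℤ) * ((n : ℤ) + a + b + c)
      + (c : ℤ) * b * b1 * ((a : ℤ) + 1 - (c1 : ℤ) * ((b1 : ℤ) - 1))
      + (a : ℤ) * c * c2 * ((b : ℤ) + 1 - (a2 : ℤ) * ((c2 : ℤ) - 1))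
      + (b : ℤ) * a * a3 * ((c : ℤ) + 1 - (b3 : ℤ) * ((a3 : ℤ) - 1))) :
    (numSol a b c n : ℚ) = (N1 : ℚ) / (2 * a * b * c)
      + ∑ i ∈ Finset.Icc 1 (b1 - 1), (⌊((i : ℚ) * c1 / a)⌋ : ℚ)
      + ∑ i ∈ Finset.Icc 1 (c2 - 1), (⌊((i : ℚ) * a2 / b)⌋ : ℚ)
      + ∑ i ∈ Finset.Icc 1 (a3 - 1), (⌊((i : ℚ) * b3 / c)⌋ : ℚ)
      - 2 := by
  obtain ⟨hb1, hb1a, hb1d⟩ := hb1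
  obtain ⟨hc2, hc2b, hc2d⟩ := hc2
  obtain ⟨ha3, ha3c, ha3d⟩ := ha3
  have hu : c * c1 ≡ b [MOD a] := by
    refine (Nat.modEq_iff_dvd.2 ?_).symm
    exact_mod_cast hc1.2.2
  have hv : a * a2 ≡ c [MOD b] := by
    refine (Nat.modEq_iff_dvd.2 ?_).symm
    exact_mod_cast ha2.2.2
  have hw : b * b3 ≡ a [MOD c] := by
    refine (Nat.modEq_iff_dvd.2 ?_).symm
    exact_mod_cast hb3.2.2
  have ha' : (a : ℚ) ≠ 0 := by positivity
  have hb' : (b : ℚ) ≠ 0 := by positivity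
  have hc' : (c : ℚ) ≠ 0 := by positivity
  have hba := Nat.Coprime.symm hab
  have hcb := Nat.Coprime.symm hbc
  have hac := Nat.Coprime.symm hca
  rw [numSol_eq_solQuasiPoly ha hb hc hab hbc hca hu hv hw, solQuasiPoly,
    periodicPart_eq_sum_floor ha hab hac hu n hb1 hb1a (by exact_mod_cast hb1d),
    periodicPart_eq_sum_floor hb hbc hba hv n hc2 hc2b (by exact_mod_cast hc2d),
    periodicPart_eq_sum_floor hc hca hcb hw n ha3 ha3c (by exact_mod_cast ha3d), hN1]
  push_cast
  field_simp
  ring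
end

section
/- Let a, b, c, n be positive integers with gcd(a,b) = gcd(b,c) = gcd(c,a) = 1. Then n(n+a+b+c)/(2abc) − (a+b+c)/2 < N(a,b,c;n) < n(n+a+b+c)/(2abc) + (a+b+c)/2. -/
/-- The partial sums of a periodic enumeration of `{0, …, a - 1}` deviate from their mean value
by at most `a * (a - 1) / 4`. -/
theorem abs_sum_range_sub_mean_le {a : ℕ} (f : ℕ → ℕ) (hlt : ∀ j, f j < a)
    (hper : ∀ j, f (a + j) = f j) (hinj : Set.InjOn f (Finset.range a)) (L : ℕ) :
    |∑ j ∈ Finset.range L, ((f j : ℚ) - ((a : ℚ) - 1) / 2)| ≤ (a : ℚ) * ((a : ℚ) - 1) / 4 := by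
  have ha : 0 < a := (Nat.zero_le _).trans_lt (hlt 0)
  have ha1 : (1 : ℚ) ≤ a := by exact_mod_cast ha
  have hterm : ∀ j, |(f j : ℚ) - ((a : ℚ) - 1) / 2| ≤ ((a : ℚ) - 1) / 2 := by
    intro j
    have h1 : (f j : ℚ) + 1 ≤ a := by exact_mod_cast hlt j
    have h0 : (0 : ℚ) ≤ f j := by positivity
    rw [abs_le]
    constructor <;> linarith
  have himage : (Finset.range a).image f = Finset.range a := by
    apply Finset.eq_of_subset_of_card_le
    · intro x hx
      obtain ⟨j, -, rfl⟩ := Finset.mem_image.1 hx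
      exact Finset.mem_range.2 (hlt j)
    · rw [Finset.card_image_of_injOn hinj]
  have hzero : ∑ j ∈ Finset.range a, ((f j : ℚ) - ((a : ℚ) - 1) / 2) = 0 := by
    rw [← Finset.sum_image (f := fun x : ℕ => (x : ℚ) - ((a : ℚ) - 1) / 2) hinj, himage]
    have hsum : ∀ m : ℕ, ∑ x ∈ Finset.range m, (x : ℚ) = m * ((m : ℚ) - 1) / 2 := by
      intro m
      induction m with
      | zero => simp
      | succ m ih => rw [Finset.sum_range_succ, ih]; push_cast; ring
    rw [Finset.sum_sub_distrib, hsum]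
    simp
    ring
  induction L using Nat.strong_induction_on with
  | _ L ih =>
  rcases le_or_gt a L with haL | hLa
  · obtain ⟨M, rfl⟩ := Nat.exists_eq_add_of_le haL
    rw [Finset.sum_range_add, hzero, zero_add]
    simp only [hper]
    exact ih M (by omega)
  · obtain ⟨M, hM⟩ := Nat.exists_eq_add_of_le hLa.le
    have hsplit : ∑ j ∈ Finset.range L, ((f j : ℚ) - ((a : ℚ) - 1) / 2)
        = -∑ j ∈ Finset.range M, ((f (L + j) : ℚ) - ((a : ℚ) - 1) / 2) := by
      have h := Finset.sum_range_add (fun j => (f j : ℚ) - ((a : ℚ) - 1) / 2) L M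
      rw [← hM, hzero] at h
      linarith
    have h1 : |∑ j ∈ Finset.range L, ((f j : ℚ) - ((a : ℚ) - 1) / 2)|
        ≤ L * (((a : ℚ) - 1) / 2) := by
      refine (Finset.abs_sum_le_sum_abs _ _).trans ?_
      simpa using Finset.sum_le_card_nsmul (Finset.range L) _ _ (fun j _ => hterm j)
    have h2 : |∑ j ∈ Finset.range L, ((f j : ℚ) - ((a : ℚ) - 1) / 2)|
        ≤ M * (((a : ℚ) - 1) / 2) := by
      rw [hsplit, abs_neg]
      refine (Finset.abs_sum_le_sum_abs _ _).trans ?_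
      simpa using Finset.sum_le_card_nsmul (Finset.range M) _ _ (fun j _ => hterm (L + j))
    have hM' : (a : ℚ) = L + M := by exact_mod_cast hM
    have h3 : (L : ℚ) * (((a : ℚ) - 1) / 2) + M * (((a : ℚ) - 1) / 2)
        = a * ((a : ℚ) - 1) / 2 := by
      rw [← add_mul, ← hM']; ring
    linarith

/-- For coprime `a` and `b`, the congruence `b * y ≡ m [MOD a]` has a solution below `a`. -/
theorem exists_lt_mul_modEq {a b : ℕ} (ha : 0 < a) (hab : Nat.Coprime a b) (m : ℕ) :
    ∃ y < a, b * y ≡ m [MOD a] := by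
  obtain ⟨t, ht⟩ := Nat.exists_mul_mod_eq_of_coprime (n := b) (k := a) m hab.symm ha.ne'
  exact ⟨t, ht⟩

/-- Solutions of `b * y ≡ r + c * j [MOD a]` along an arithmetic progression are
equidistributed. -/
theorem exists_modEq_equidistributed {a b c : ℕ} (ha : 0 < a) (hab : Nat.Coprime a b)
    (hac : Nat.Coprime a c) (r : ℕ) :
    ∃ f : ℕ → ℕ, (∀ j, f j < a) ∧ (∀ j, b * f j ≡ r + c * j [MOD a]) ∧
      ∀ L : ℕ, |∑ j ∈ Finset.range L, ((f j : ℚ) - ((a : ℚ) - 1) / 2)|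
        ≤ (a : ℚ) * ((a : ℚ) - 1) / 4 := by
  choose f hlt hmod using fun j => exists_lt_mul_modEq ha hab (r + c * j)
  refine ⟨f, hlt, hmod, abs_sum_range_sub_mean_le f hlt ?_ ?_⟩
  · intro j
    have h : b * f (a + j) ≡ b * f j [MOD a] := by
      refine (hmod (a + j)).trans (Nat.ModEq.trans ?_ (hmod j).symm)
      have : r + c * (a + j) = r + c * j + a * c := by ring
      rw [this]
      simp [Nat.ModEq]
    exact (Nat.ModEq.cancel_left_of_coprime hab h).eq_of_lt_of_lt (hlt _) (hlt _)
  · intro i hi j hj hij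
    have h : r + c * i ≡ r + c * j [MOD a] := by
      refine (hmod i).symm.trans ?_
      rw [hij]
      exact hmod j
    have h' := Nat.ModEq.cancel_left_of_coprime hac (Nat.ModEq.add_left_cancel' r h)
    exact h'.eq_of_lt_of_lt (by simpa using hi) (by simpa using hj)

/-- Popoviciu's formula for the number of nonnegative solutions of `a * x + b * y = m`. -/
theorem ncard_linear_two {a b m x₀ y₀ : ℕ} (ha : 0 < a) (hb : 0 < b) (hab : Nat.Coprime a b)
    (hx : x₀ < b) (hy : y₀ < a) (hxm : a * x₀ ≡ m [MOD b]) (hym : b * y₀ ≡ m [MOD a]) :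
    (({q : ℕ × ℕ | a * q.1 + b * q.2 = m}.ncard : ℕ) : ℚ) * (a * b)
      = m - a * x₀ - b * y₀ + a * b := by
  have hform : ∀ x y : ℕ, a * x + b * y = m → ∃ i j, x = x₀ + b * i ∧ y = y₀ + a * j := by
    intro x y h
    have h1 : x₀ ≡ x [MOD b] := by
      refine Nat.ModEq.cancel_left_of_coprime hab.symm (hxm.trans ?_)
      rw [← h]
      simp [Nat.ModEq]
    have h2 : y₀ ≡ y [MOD a] := by
      refine Nat.ModEq.cancel_left_of_coprime hab (hym.trans ?_)
      rw [← h]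
      simp [Nat.ModEq]
    refine ⟨x / b, y / a, ?_, ?_⟩
    · have := Nat.mod_add_div x b
      rw [← h1, Nat.mod_eq_of_lt hx] at this
      exact this.symm
    · have := Nat.mod_add_div y a
      rw [← h2, Nat.mod_eq_of_lt hy] at this
      exact this.symm
  have hdvd : (a : ℤ) * b ∣ (m : ℤ) - a * x₀ - b * y₀ := by
    apply IsCoprime.mul_dvd (Nat.isCoprime_iff_coprime.2 hab)
    · have h := hym.dvd
      push_cast at h
      have : (m : ℤ) - a * x₀ - b * y₀ = (m - b * y₀) - a * x₀ := by ring
      rw [this]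
      exact dvd_sub h (dvd_mul_right _ _)
    · have h := hxm.dvd
      push_cast at h
      exact dvd_sub h (dvd_mul_right _ _)
  obtain ⟨k, hk⟩ := hdvd
  have ha' : (0 : ℤ) < a := by exact_mod_cast ha
  have hb' : (0 : ℤ) < b := by exact_mod_cast hb
  have hx' : (x₀ : ℤ) + 1 ≤ b := by exact_mod_cast hx
  have hy' : (y₀ : ℤ) + 1 ≤ a := by exact_mod_cast hy
  have hk1 : -1 ≤ k := by
    by_contra! hlt
    have h2 : (a : ℤ) * b * k ≤ a * b * (-2) :=
      mul_le_mul_of_nonneg_left (by omega) (by positivity)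
    have h3 := mul_le_mul_of_nonneg_left hx' ha'.le
    have h4 := mul_le_mul_of_nonneg_left hy' hb'.le
    have h5 : (0 : ℤ) ≤ m := by positivity
    nlinarith
  have hkq : (m : ℚ) - a * x₀ - b * y₀ = a * b * k := by exact_mod_cast hk
  have hcard : (({q : ℕ × ℕ | a * q.1 + b * q.2 = m}.ncard : ℕ) : ℤ) = k + 1 := by
    have hiff : ∀ i j : ℕ, a * (x₀ + b * i) + b * (y₀ + a * j) = m ↔ (i : ℤ) + j = k := by
      intro i j
      have hab0 : (a : ℤ) * b ≠ 0 := by positivity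
      zify
      constructor
      · intro h
        apply mul_left_cancel₀ hab0
        linear_combination h + hk
      · intro h
        linear_combination (a : ℤ) * b * h - hk
    obtain rfl | hk0 : k = -1 ∨ 0 ≤ k := by omega
    · have : {q : ℕ × ℕ | a * q.1 + b * q.2 = m} = ∅ := by
        ext ⟨x, y⟩
        simp only [Set.mem_ofPred_eq, Set.mem_empty_iff_false, iff_false]
        intro h
        obtain ⟨i, j, rfl, rfl⟩ := hform x y h
        have := (hiff i j).1 h
        omega
      simp [this]
    · lift k to ℕ using hk0
      have : {q : ℕ × ℕ | a * q.1 + b * q.2 = m}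
          = (fun p : ℕ × ℕ => (x₀ + b * p.1, y₀ + a * p.2)) ''
            ((Finset.HasAntidiagonal.antidiagonal k : Finset (ℕ × ℕ)) : Set (ℕ × ℕ)) := by
        ext ⟨x, y⟩
        simp only [Set.mem_ofPred_eq, Set.mem_image, Finset.mem_coe, Finset.HasAntidiagonal.mem_antidiagonal,
          Prod.mk.injEq, Prod.exists]
        constructor
        · intro h
          obtain ⟨i, j, rfl, rfl⟩ := hform x y h
          have := (hiff i j).1 h
          exact ⟨i, j, by omega, rfl, rfl⟩
        · rintro ⟨i, j, h, rfl, rfl⟩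
          exact (hiff i j).2 (by exact_mod_cast h)
      rw [this, Set.ncard_image_of_injective, Set.ncard_coe_finset, Finset.Nat.card_antidiagonal]
      · push_cast; ring
      · rintro ⟨i, j⟩ ⟨i', j'⟩ h
        simpa [ha.ne', hb.ne'] using h
  have hcardq : (({q : ℕ × ℕ | a * q.1 + b * q.2 = m}.ncard : ℕ) : ℚ) = k + 1 := by
    exact_mod_cast hcard
  rw [hcardq, hkq]
  ring

/-- Counting the triples according to their last coordinate. -/
theorem numSol_eq_sum {a b c r K : ℕ} (ha : 0 < a) (hb : 0 < b) (hr : r < c) :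
    numSol a b c (r + c * K)
      = ∑ j ∈ Finset.range (K + 1), {q : ℕ × ℕ | a * q.1 + b * q.2 = r + c * j}.ncard := by
  have hfin : ∀ m, {q : ℕ × ℕ | a * q.1 + b * q.2 = m}.Finite := by
    intro m
    refine (Finset.range (m + 1) ×ˢ Finset.range (m + 1)).finite_toSet.subset ?_
    rintro ⟨x, y⟩ h
    simp only [Set.mem_ofPred_eq] at h
    simp only [Finset.coe_product, Set.mem_prod, Finset.coe_range, Set.mem_Iio]
    constructor <;> nlinarith
  have hset : {p : ℕ × ℕ × ℕ | a * p.1 + b * p.2.1 + c * p.2.2 = r + c * K}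
      = ((Finset.range (K + 1)).sigma fun j => (hfin (r + c * j)).toFinset).image
          (fun s => (s.2.1, s.2.2, K - s.1)) := by
    ext ⟨x, y, z⟩
    simp only [Set.mem_ofPred_eq, Finset.coe_image, Set.mem_image, Finset.mem_coe,
      Finset.mem_sigma, Finset.mem_range, Set.Finite.mem_toFinset, Prod.mk.injEq, Sigma.exists,
      Prod.exists]
    constructor
    · intro h
      have hz : z ≤ K := by
        by_contra! hlt
        have : c * (K + 1) ≤ c * z := Nat.mul_le_mul_left c hlt
        rw [mul_add] at this
        omega
      obtain ⟨j, rfl⟩ := Nat.exists_eq_add_of_le hz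
      refine ⟨j, x, y, ⟨by omega, ?_⟩, rfl, rfl, by omega⟩
      rw [mul_add] at h
      omega
    · rintro ⟨j, x, y, ⟨hj, h⟩, rfl, rfl, rfl⟩
      obtain ⟨z, rfl⟩ := Nat.exists_eq_add_of_le (Nat.lt_succ_iff.1 hj)
      rw [Nat.add_sub_cancel_left, h]
      ring
  rw [numSol, hset, Set.ncard_coe_finset, Finset.card_image_of_injOn, Finset.card_sigma]
  · exact Finset.sum_congr rfl fun j _ => (Set.ncard_eq_toFinset_card _ (hfin _)).symm
  · rintro ⟨j, x, y⟩ h ⟨j', x', y'⟩ h' heq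
    simp only [Finset.mem_coe, Finset.mem_sigma, Finset.mem_range] at h h'
    simp only [Prod.mk.injEq] at heq
    obtain ⟨rfl, rfl, hjj⟩ := heq
    obtain rfl : j = j' := by omega
    rfl

theorem stmt_2 (a b c n : ℕ)
    (ha : 0 < a) (hb : 0 < b) (hc : 0 < c) (hn : 0 < n)
    (hab : Nat.gcd a b = 1) (hbc : Nat.gcd b c = 1) (hca : Nat.gcd c a = 1) :
    (n : ℚ) * ((n : ℚ) + a + b + c) / (2 * a * b * c) - ((a : ℚ) + b + c) / 2
      < (numSol a b c n : ℚ) ∧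
    (numSol a b c n : ℚ)
      < (n : ℚ) * ((n : ℚ) + a + b + c) / (2 * a * b * c) + ((a : ℚ) + b + c) / 2 := by
  obtain ⟨r, K, hr, rfl⟩ : ∃ r K, r < c ∧ n = r + c * K :=
    ⟨n % c, n / c, Nat.mod_lt _ hc, (Nat.mod_add_div n c).symm⟩
  have hba : Nat.Coprime b a := Nat.Coprime.symm hab
  have hac : Nat.Coprime a c := Nat.Coprime.symm hca
  obtain ⟨f, hf, hfm, hfs⟩ := exists_modEq_equidistributed ha hab hac r
  obtain ⟨g, hg, hgm, hgs⟩ := exists_modEq_equidistributed hb hba hbc r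
  have hN := numSol_eq_sum (K := K) ha hb hr
  set N := numSol a b c (r + c * K)
  set δ := ∑ j ∈ Finset.range (K + 1), ((f j : ℚ) - ((a : ℚ) - 1) / 2) with hδ
  set ε := ∑ j ∈ Finset.range (K + 1), ((g j : ℚ) - ((b : ℚ) - 1) / 2) with hε
  have hmain : (N : ℚ) * (a * b)
      = (K + 1) * (r + c * K / 2 + (a + b) / 2) - b * δ - a * ε := by
    have hlin : ∀ L : ℕ, ∑ j ∈ Finset.range L, ((r : ℚ) + c * j + (a + b) / 2)
        = L * (r + c * (L - 1) / 2 + (a + b) / 2) := by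
      intro L
      induction L with
      | zero => simp
      | succ L ih => rw [Finset.sum_range_succ, ih]; push_cast; ring
    have hlinK := hlin (K + 1)
    push_cast at hlinK
    rw [add_sub_cancel_right] at hlinK
    rw [← hlinK, hδ, hε, hN, Finset.mul_sum, Finset.mul_sum, ← Finset.sum_sub_distrib,
      ← Finset.sum_sub_distrib]
    push_cast
    rw [Finset.sum_mul]
    refine Finset.sum_congr rfl fun j _ => ?_
    rw [ncard_linear_two ha hb hab (hg j) (hf j) (hgm j) (hfm j)]
    push_cast
    ring
  have hδ' := abs_le.1 (hfs (K + 1))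
  have hε' := abs_le.1 (hgs (K + 1))
  rw [← hδ] at hδ'
  rw [← hε] at hε'
  have ha1 : (1 : ℚ) ≤ a := by exact_mod_cast ha
  have hb1 : (1 : ℚ) ≤ b := by exact_mod_cast hb
  have hc1 : (1 : ℚ) ≤ c := by exact_mod_cast hc
  have hr1 : (r : ℚ) < c := by exact_mod_cast hr
  have hr0 : (0 : ℚ) ≤ r := by positivity
  have habc : (0 : ℚ) < 2 * a * b * c := by positivity
  push_cast
  generalize (N : ℚ) = N at *
  generalize (a : ℚ) = a at *
  generalize (b : ℚ) = b at *
  generalize (c : ℚ) = c at *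
  generalize (r : ℚ) = r at *
  generalize (K : ℚ) = K at *
  have hdev : N * (2 * a * b * c) - (r + c * K) * (r + c * K + a + b + c)
      = (c - r) * (r + a + b) - 2 * c * (b * δ) - 2 * c * (a * ε) := by
    linear_combination 2 * c * hmain
  have hcb : 0 < c * b := by positivity
  have hca : 0 < c * a := by positivity
  have hδl := mul_le_mul_of_nonneg_left hδ'.1 hcb.le
  have hδu := mul_le_mul_of_nonneg_left hδ'.2 hcb.le
  have hεl := mul_le_mul_of_nonneg_left hε'.1 hca.le
  have hεu := mul_le_mul_of_nonneg_left hε'.2 hca.le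
  have habc1 : 0 < a * b * c := by positivity
  constructor
  · rw [sub_lt_iff_lt_add, div_lt_iff₀ habc]
    have h1 : 0 < (c - r) * (r + a + b) := mul_pos (by linarith) (by linarith)
    have h2 : 0 < a * b * c * (a + b + c) := by positivity
    have h3 : 0 < a * b * c * c := by positivity
    nlinarith
  · rw [← sub_lt_iff_lt_add, lt_div_iff₀ habc]
    have h1 : (c - r) * r ≤ c * c / 4 := by nlinarith [sq_nonneg (c - 2 * r)]
    have h2 : (c - r) * (a + b) ≤ c * (a + b) :=
      mul_le_mul_of_nonneg_right (by linarith) (by linarith)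
    have h3 : c * c ≤ a * b * (c * c) :=
      le_mul_of_one_le_left (by positivity) (one_le_mul_of_one_le_of_one_le ha1 hb1)
    have h4 : c * b * 2 ≤ c * b * (a * (a + 1)) :=
      mul_le_mul_of_nonneg_left (by nlinarith) hcb.le
    have h5 : c * a * 2 ≤ c * a * (b * (b + 1)) :=
      mul_le_mul_of_nonneg_left (by nlinarith) hca.le
    have h6 : 0 < c * c := by positivity
    nlinarith
end

section
/- Let a, b, c be positive integers with gcd(a,b) = gcd(b,c) = gcd(c,a) = 1. Set α = (a+b+c)/2, β = 2abc, M = ⌊((2αβ−1)² − 4α²)/(4β) + α⌋ + 1, γ_k = ⌊√(β(k+α) + α²) − α⌋ and δ_k = ⌊√(β(k−α) + α²) − α⌋. Suppose k ≥ M, γ_k ≠ δ_k, and N(a,b,c;γ_k) = k. Then for every nonnegative integer t, N(a,b,c;t) = k if and only if t = γ_k; that is, R_k(a,b,c) = {γ_k}. -/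
/-- The residues modulo `c` of a full period of an arithmetic progression with step coprime
to `c` sum to `c * (c - 1) / 2`. -/
theorem two_mul_sum_emod_period (c : ℕ) (hc : 0 < c) (A D : ℤ) (hD : IsCoprime D (c : ℤ)) :
    2 * ∑ x ∈ Finset.range c, (A + D * (x : ℤ)) % (c : ℤ) = (c : ℤ) * (c - 1) := by
  have hc' : (0 : ℤ) < c := by exact_mod_cast hc
  have hmaps : ∀ x ∈ Finset.range c, ((A + D * (x : ℤ)) % (c : ℤ)).toNat ∈ Finset.range c := by
    intro x _
    have h1 := Int.emod_nonneg (A + D * (x : ℤ)) hc'.ne'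
    have h2 := Int.emod_lt_of_pos (A + D * (x : ℤ)) hc'
    rw [Finset.mem_range]
    omega
  have hinj : Set.InjOn (fun x : ℕ => ((A + D * (x : ℤ)) % (c : ℤ)).toNat)
      (Finset.range c : Set ℕ) := by
    intro x hx y hy hxy
    simp only [Finset.coe_range, Set.mem_Iio] at hx hy
    have h1 := Int.emod_nonneg (A + D * (x : ℤ)) hc'.ne'
    have h2 := Int.emod_nonneg (A + D * (y : ℤ)) hc'.ne'
    have h3 : (A + D * (x : ℤ)) % (c : ℤ) = (A + D * (y : ℤ)) % (c : ℤ) := by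
      simp only at hxy
      omega
    have h4 : (c : ℤ) ∣ D * ((y : ℤ) - x) := by
      have := Int.ModEq.dvd h3
      ring_nf at this ⊢
      exact this
    have h5 : (c : ℤ) ∣ (y : ℤ) - x := hD.symm.dvd_of_dvd_mul_left h4
    have h6 : (y : ℤ) - x = 0 := by
      apply Int.eq_zero_of_abs_lt_dvd h5
      rw [abs_lt]
      omega
    omega
  have hsum : ∑ x ∈ Finset.range c, ((A + D * (x : ℤ)) % (c : ℤ)).toNat
      = ∑ x ∈ Finset.range c, x :=
    Finset.sum_nbij (fun x : ℕ => ((A + D * (x : ℤ)) % (c : ℤ)).toNat) hmaps hinj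
      (Finset.surjOn_of_injOn_of_card_le _ hmaps hinj le_rfl) (fun _ _ => rfl)
  have hcast : ∑ x ∈ Finset.range c, (A + D * (x : ℤ)) % (c : ℤ)
      = ((∑ x ∈ Finset.range c, ((A + D * (x : ℤ)) % (c : ℤ)).toNat : ℕ) : ℤ) := by
    push_cast
    refine Finset.sum_congr rfl fun x _ => ?_
    exact (Int.toNat_of_nonneg (Int.emod_nonneg (A + D * (x : ℤ)) hc'.ne')).symm
  have hg := Finset.sum_range_id_mul_two c
  rw [hcast, hsum, mul_comm]
  have : ((c - 1 : ℕ) : ℤ) = (c : ℤ) - 1 := by omega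
  rw [← this]
  exact_mod_cast hg

/-- Discrepancy of the residues modulo `c` of an arithmetic progression with step coprime
to `c`. -/
theorem abs_two_mul_sum_emod_sub_le (c : ℕ) (hc : 0 < c) (D : ℤ) (hD : IsCoprime D (c : ℤ))
    (n : ℕ) : ∀ A : ℤ,
    |2 * ∑ x ∈ Finset.range n, (A + D * (x : ℤ)) % (c : ℤ) - n * ((c : ℤ) - 1)|
      ≤ ((c : ℤ) - 1) ^ 2 := by
  have hc' : (0 : ℤ) < c := by exact_mod_cast hc
  induction n using Nat.strong_induction_on with
  | _ n ih =>
    intro A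
    rcases lt_or_ge n c with hn | hn
    · have h1 : 2 * ∑ x ∈ Finset.range n, (A + D * (x : ℤ)) % (c : ℤ) - n * ((c : ℤ) - 1)
          = ∑ x ∈ Finset.range n, (2 * ((A + D * (x : ℤ)) % (c : ℤ)) - ((c : ℤ) - 1)) := by
        rw [Finset.sum_sub_distrib, ← Finset.mul_sum, Finset.sum_const,
          Finset.card_range, nsmul_eq_mul]
      have h2 : ∑ x ∈ Finset.range n, |2 * ((A + D * (x : ℤ)) % (c : ℤ)) - ((c : ℤ) - 1)|
          ≤ ∑ _x ∈ Finset.range n, ((c : ℤ) - 1) := by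
        refine Finset.sum_le_sum fun x _ => ?_
        have h1 := Int.emod_nonneg (A + D * (x : ℤ)) hc'.ne'
        have h2 := Int.emod_lt_of_pos (A + D * (x : ℤ)) hc'
        rw [abs_le]
        omega
      rw [h1]
      refine (Finset.abs_sum_le_sum_abs _ _).trans (h2.trans ?_)
      simp only [Finset.sum_const, Finset.card_range, nsmul_eq_mul]
      have : (n : ℤ) ≤ c - 1 := by omega
      nlinarith
    · obtain ⟨m, rfl⟩ := Nat.exists_eq_add_of_le hn
      have hshift : ∀ x : ℕ, (A + D * ((c + x : ℕ) : ℤ)) % (c : ℤ)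
          = (A + D * (x : ℤ)) % (c : ℤ) := by
        intro x
        rw [show A + D * ((c + x : ℕ) : ℤ) = A + D * (x : ℤ) + c * D by push_cast; ring,
          Int.add_mul_emod_self_left]
      have h := ih m (by omega) A
      have hp := two_mul_sum_emod_period c hc A D hD
      rw [Finset.sum_range_add]
      simp only [hshift]
      rw [mul_add, hp]
      convert h using 2
      push_cast
      ring

/-- The number of representations of `m` as `b * y + c * z`, from a reduced integer
representation. -/
theorem ncard_two_coin (b c m : ℕ) (hb : 0 < b) (hc : 0 < c) (hbc : IsCoprime (b : ℤ) c)
    (y₀ z₀ q : ℤ) (hy : 0 ≤ y₀) (hyc : y₀ < c) (hz : 0 ≤ z₀) (hzb : z₀ < b)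
    (h : b * y₀ + c * z₀ + b * c * q = m) :
    (({p : ℕ × ℕ | b * p.1 + c * p.2 = m}.ncard : ℕ) : ℤ) = q + 1 := by
  have hb' : (0 : ℤ) < b := by exact_mod_cast hb
  have hc' : (0 : ℤ) < c := by exact_mod_cast hc
  have hq : -1 ≤ q := by
    by_contra! hq
    have h0 : (0 : ℤ) ≤ m := by positivity
    have h1 : (b : ℤ) * c * q ≤ b * c * (-2) :=
      mul_le_mul_of_nonneg_left (by omega) (by positivity)
    nlinarith
  have key : {p : ℕ × ℕ | b * p.1 + c * p.2 = m} =
      ((Finset.range (q + 1).toNat).image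
        (fun j : ℕ => ((y₀ + c * j).toNat, (z₀ + b * (q - j)).toNat)) : Finset (ℕ × ℕ)) := by
    ext ⟨y, z⟩
    simp only [Set.mem_ofPred_eq, Finset.coe_image, Set.mem_image, Finset.coe_range, Set.mem_Iio,
      Prod.mk.injEq]
    constructor
    · intro hyz
      have hyz' : (b : ℤ) * y + c * z = m := by exact_mod_cast hyz
      have hd : (c : ℤ) ∣ b * (y - y₀) := ⟨z₀ + b * q - z, by linear_combination hyz' - h⟩
      obtain ⟨j, hj⟩ := hbc.symm.dvd_of_dvd_mul_left hd
      have hzj : (z : ℤ) = z₀ + b * (q - j) := by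
        have : (c : ℤ) * (z - (z₀ + b * (q - j))) = 0 := by
          linear_combination hyz' - h - b * hj
        rcases mul_eq_zero.1 this with h1 | h1 <;> omega
      have hj0 : 0 ≤ j := by
        by_contra! hj0
        have : (c : ℤ) * j ≤ c * (-1) := mul_le_mul_of_nonneg_left (by omega) hc'.le
        omega
      have hjq : j ≤ q := by
        by_contra! hjq
        have : (b : ℤ) * (q - j) ≤ b * (-1) := mul_le_mul_of_nonneg_left (by omega) hb'.le
        omega
      have hjc : ((j.toNat : ℕ) : ℤ) = j := Int.toNat_of_nonneg hj0
      refine ⟨j.toNat, by omega, ?_, ?_⟩ <;> rw [hjc] <;> omega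
    · rintro ⟨j, hj, rfl, rfl⟩
      have h1 : 0 ≤ y₀ + c * (j : ℤ) := by positivity
      have h2 : 0 ≤ z₀ + b * (q - j) :=
        add_nonneg hz (mul_nonneg hb'.le (by omega))
      zify
      rw [Int.toNat_of_nonneg h1, Int.toNat_of_nonneg h2]
      linear_combination h
  rw [key, Set.ncard_coe_finset, Finset.card_image_of_injOn]
  · rw [Finset.card_range]
    omega
  · intro i _ j _ hij
    simp only [Prod.mk.injEq] at hij
    have h1 : 0 ≤ (c : ℤ) * i := by positivity
    have h2 : 0 ≤ (c : ℤ) * j := by positivity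
    have h3 : (c : ℤ) * i = c * j := by omega
    exact_mod_cast mul_left_cancel₀ hc'.ne' h3

theorem finite_setOf_add_eq (b c m : ℕ) (hb : 0 < b) (hc : 0 < c) :
    {p : ℕ × ℕ | b * p.1 + c * p.2 = m}.Finite := by
  refine ((Set.finite_Iic m).prod (Set.finite_Iic m)).subset ?_
  rintro ⟨y, z⟩ h
  simp only [Set.mem_ofPred_eq] at h
  simp only [Set.mem_prod, Set.mem_Iic]
  constructor <;> nlinarith

theorem numSol_eq_sum_s7 (a b c t : ℕ) (ha : 0 < a) (hb : 0 < b) (hc : 0 < c) :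
    numSol a b c t = ∑ x ∈ Finset.range (t / a + 1),
      {p : ℕ × ℕ | b * p.1 + c * p.2 = t - a * x}.ncard := by
  classical
  have key : {p : ℕ × ℕ × ℕ | a * p.1 + b * p.2.1 + c * p.2.2 = t} =
      (((Finset.range (t / a + 1)).biUnion fun x =>
        (finite_setOf_add_eq b c (t - a * x) hb hc).toFinset.image (Prod.mk x)) :
          Finset (ℕ × ℕ × ℕ)) := by
    ext ⟨x, y, z⟩
    simp only [Set.mem_ofPred_eq, Finset.coe_biUnion, Finset.coe_range, Set.mem_Iio,
      Finset.coe_image, Set.Finite.coe_toFinset, Set.mem_iUnion, Set.mem_image, Prod.mk.injEq,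
      Prod.exists, exists_prop, Nat.lt_succ_iff, Nat.le_div_iff_mul_le ha]
    constructor
    · intro h
      exact ⟨x, by rw [mul_comm]; omega, y, z, by omega, rfl, rfl, rfl⟩
    · rintro ⟨x, hx, y, z, h, rfl, rfl, rfl⟩
      rw [mul_comm] at hx
      omega
  rw [numSol, key, Set.ncard_coe_finset, Finset.card_biUnion]
  · refine Finset.sum_congr rfl fun x _ => ?_
    rw [Finset.card_image_of_injective _ (Prod.mk_right_injective x),
      Set.ncard_eq_toFinset_card _ (finite_setOf_add_eq b c (t - a * x) hb hc)]
  · intro x _ y _ hxy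
    simp only [Function.onFun]
    rw [Finset.disjoint_left]
    rintro p hp hq
    obtain ⟨u, _, rfl⟩ := Finset.mem_image.1 hp
    obtain ⟨v, _, h⟩ := Finset.mem_image.1 hq
    exact hxy (Prod.mk.inj h).1.symm

/-- The denumerant of three pairwise coprime integers, up to an error controlled by two
discrepancies. -/
theorem exists_numSol_eq (a b c t : ℕ) (ha : 0 < a) (hb : 0 < b) (hc : 0 < c)
    (hab : IsCoprime (a : ℤ) b) (hbc : IsCoprime (b : ℤ) c) (hac : IsCoprime (a : ℤ) c) :
    ∃ e f : ℤ, |e| ≤ ((c : ℤ) - 1) ^ 2 ∧ |f| ≤ ((b : ℤ) - 1) ^ 2 ∧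
      2 * (b : ℤ) * c * numSol a b c t =
        2 * (t / a + 1 : ℕ) * (t : ℤ) - a * (t / a + 1 : ℕ) * (t / a : ℕ)
          + (t / a + 1 : ℕ) * ((b : ℤ) + c) - b * e - c * f := by
  have hb' : (0 : ℤ) < b := by exact_mod_cast hb
  have hc' : (0 : ℤ) < c := by exact_mod_cast hc
  obtain ⟨u, v, huv⟩ := id hbc
  have hu : IsCoprime u (c : ℤ) := ⟨b, v, by linear_combination huv⟩
  have hv : IsCoprime v (b : ℤ) := ⟨c, u, by linear_combination huv⟩
  set n := t / a + 1 with hn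
  have hDc : IsCoprime (-(u * a)) (c : ℤ) := (hu.mul_left hac).neg_left
  have hDb : IsCoprime (-(v * a)) (b : ℤ) := (hv.mul_left hab).neg_left
  refine ⟨_, _, abs_two_mul_sum_emod_sub_le c hc _ hDc n (u * t),
    abs_two_mul_sum_emod_sub_le b hb _ hDb n (v * t), ?_⟩
  have hterm : ∀ x ∈ Finset.range n,
      (b : ℤ) * c * (({p : ℕ × ℕ | b * p.1 + c * p.2 = t - a * x}.ncard : ℕ) : ℤ)
      = (t + b * c - a * x) - b * ((u * t + -(u * a) * (x : ℤ)) % (c : ℤ))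
        - c * ((v * t + -(v * a) * (x : ℤ)) % (b : ℤ)) := by
    intro x hx
    have hx' : a * x ≤ t := by
      rw [Finset.mem_range, hn, Nat.lt_succ_iff, Nat.le_div_iff_mul_le ha] at hx
      rwa [mul_comm]
    have e1 := Int.mul_ediv_add_emod (u * t + -(u * a) * (x : ℤ)) c
    have e2 := Int.mul_ediv_add_emod (v * t + -(v * a) * (x : ℤ)) b
    set Y := (u * t + -(u * a) * (x : ℤ)) % (c : ℤ)
    set Z := (v * t + -(v * a) * (x : ℤ)) % (b : ℤ)
    set p := (u * t + -(u * a) * (x : ℤ)) / (c : ℤ)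
    set r := (v * t + -(v * a) * (x : ℤ)) / (b : ℤ)
    have hrep : (b : ℤ) * Y + c * Z + b * c * (p + r) = ((t - a * x : ℕ) : ℤ) := by
      push_cast [hx']
      linear_combination (b : ℤ) * e1 + c * e2 + (t - a * x : ℤ) * huv
    have := ncard_two_coin b c (t - a * x) hb hc hbc Y Z (p + r)
      (Int.emod_nonneg _ hc'.ne') (Int.emod_lt_of_pos _ hc')
      (Int.emod_nonneg _ hb'.ne') (Int.emod_lt_of_pos _ hb') hrep
    rw [this]
    push_cast [hx'] at hrep
    linear_combination hrep
  have hsum : (b : ℤ) * c * numSol a b c t = ∑ x ∈ Finset.range n,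
      ((t + b * c - a * x) - b * ((u * t + -(u * a) * (x : ℤ)) % (c : ℤ))
        - c * ((v * t + -(v * a) * (x : ℤ)) % (b : ℤ))) := by
    rw [numSol_eq_sum_s7 a b c t ha hb hc, Nat.cast_sum, Finset.mul_sum]
    exact Finset.sum_congr rfl hterm
  simp only [Finset.sum_sub_distrib, ← Finset.mul_sum, Finset.sum_const, Finset.card_range,
    nsmul_eq_mul] at hsum
  have hg : (∑ x ∈ Finset.range n, (x : ℤ)) * 2 = n * (t / a : ℕ) := by
    have := Finset.sum_range_id_mul_two n
    rw [show n - 1 = t / a from Nat.add_sub_cancel _ _] at this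
    rw [← Nat.cast_sum, ← Nat.cast_mul, ← this]
    push_cast
    rfl
  linear_combination 2 * hsum - a * hg

/-- The denumerant of three pairwise coprime integers differs from its polynomial
approximation by at most `(a + b + c) / 2`, strictly from above. -/
theorem numSol_bounds (a b c t : ℕ) (ha : 0 < a) (hb : 0 < b) (hc : 0 < c)
    (hab : IsCoprime (a : ℤ) b) (hbc : IsCoprime (b : ℤ) c) (hac : IsCoprime (a : ℤ) c) :
    (t : ℤ) ^ 2 + (a + b + c) * t ≤ 2 * a * b * c * numSol a b c t + a * b * c * (a + b + c) ∧
    2 * (a : ℤ) * b * c * numSol a b c t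
      < (t : ℤ) ^ 2 + (a + b + c) * t + a * b * c * (a + b + c) := by
  obtain ⟨e, f, he, hf, h⟩ := exists_numSol_eq a b c t ha hb hc hab hbc hac
  have hdiv := Nat.div_add_mod t a
  have hmod := Nat.mod_lt t ha
  generalize t / a = n at *
  generalize t % a = r at *
  generalize numSol a b c t = N at *
  rw [abs_le] at he hf
  zify at ha hb hc hdiv hmod
  have hr : (0 : ℤ) ≤ r := by positivity
  obtain ⟨s, hs⟩ : ∃ s : ℤ, s = a - r := ⟨_, rfl⟩
  have hs1 : 1 ≤ s := by omega
  have hsa : s ≤ a := by omega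
  push_cast at h
  have hn : (a : ℤ) * (n + 1) = t + s := by linear_combination hdiv - hs
  generalize (a : ℤ) = a at *
  generalize (b : ℤ) = b at *
  generalize (c : ℤ) = c at *
  generalize (t : ℤ) = t at *
  generalize (N : ℤ) = N at *
  generalize (n : ℤ) = n at *
  have hmain : 2 * a * b * c * N =
      t ^ 2 + (a + b + c) * t + s * (a + b + c - s) - a * (b * e + c * f) := by
    have hn' : a * n = t + s - a := by linear_combination hn
    linear_combination a * h + (2 * t + b + c - a * n) * hn - (t + s) * hn'
  have hE : |b * e + c * f| ≤ b * (c - 1) ^ 2 + c * (b - 1) ^ 2 := by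
    rw [abs_le]
    constructor <;> nlinarith
  rw [abs_le] at hE
  have hbc1 : 0 ≤ (b - 1) * (c - 1) := mul_nonneg (by omega) (by omega)
  have hS0 : 0 ≤ s * (a + b + c - s) := mul_nonneg (by omega) (by omega)
  have hS1 : s * (a + b + c - s) ≤ a * (a + b + c - 1) :=
    mul_le_mul hsa (by omega) (by omega) (by omega)
  have habc : a ≤ a * (b * c) := by nlinarith
  constructor
  · have h1 : a * (b * e + c * f) ≤ a * (b * c * (a + b + c)) := by
      refine mul_le_mul_of_nonneg_left ?_ ha.le
      have : 0 ≤ a * (b * c) := by positivity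
      nlinarith
    linarith
  · have h1 : a * (a + b + c - 1 - (b * e + c * f)) < a * (b * c * (a + b + c)) := by
      refine mul_lt_mul_of_pos_left ?_ ha
      nlinarith
    linarith

theorem stmt_7 (a b c : ℕ)
    (ha : 0 < a) (hb : 0 < b) (hc : 0 < c)
    (hab : Nat.gcd a b = 1) (hbc : Nat.gcd b c = 1) (hca : Nat.gcd c a = 1)
    (α β : ℝ) (hα : α = ((a : ℝ) + b + c) / 2) (hβ : β = 2 * a * b * c)
    (M : ℤ) (hM : M = ⌊((2 * α * β - 1) ^ 2 - 4 * α ^ 2) / (4 * β) + α⌋ + 1)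
    (k : ℕ)
    (γ δ : ℤ)
    (hγ : γ = ⌊Real.sqrt (β * ((k : ℝ) + α) + α ^ 2) - α⌋)
    (hδ : δ = ⌊Real.sqrt (β * ((k : ℝ) - α) + α ^ 2) - α⌋)
    (hk : M ≤ (k : ℤ)) (hγδ : γ ≠ δ)
    (hsol : {p : ℕ × ℕ × ℕ |
      (a : ℤ) * p.1 + (b : ℤ) * p.2.1 + (c : ℤ) * p.2.2 = γ}.ncard = k) :
    ∀ t : ℕ, numSol a b c t = k ↔ (t : ℤ) = γ := by
  have hab' : IsCoprime (a : ℤ) b := Nat.isCoprime_iff_coprime.2 hab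
  have hbc' : IsCoprime (b : ℤ) c := Nat.isCoprime_iff_coprime.2 hbc
  have hac' : IsCoprime (a : ℤ) c := (Nat.isCoprime_iff_coprime.2 hca).symm
  intro t
  constructor
  · intro ht
    obtain ⟨h1, h2⟩ := numSol_bounds a b c t ha hb hc hab' hbc' hac'
    rw [ht] at h1 h2
    have ha' : (1 : ℝ) ≤ a := by exact_mod_cast ha
    have hb' : (1 : ℝ) ≤ b := by exact_mod_cast hb
    have hc' : (1 : ℝ) ≤ c := by exact_mod_cast hc
    have hα1 : 1 ≤ α := by linarith
    have hβ1 : 1 ≤ β := by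
      have := one_le_mul_of_one_le_of_one_le (one_le_mul_of_one_le_of_one_le ha' hb') hc'
      linarith
    have ht0 : (0 : ℝ) ≤ t := by positivity
    have h1' : ((t : ℝ) + α) ^ 2 ≤ β * (k + α) + α ^ 2 := by
      have : (t : ℝ) ^ 2 + (a + b + c) * t ≤ 2 * a * b * c * k + a * b * c * (a + b + c) := by
        exact_mod_cast h1
      rw [hα, hβ]
      linarith
    have h2' : β * (k - α) + α ^ 2 < ((t : ℝ) + α) ^ 2 := by
      have : 2 * (a : ℝ) * b * c * k < (t : ℝ) ^ 2 + (a + b + c) * t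
          + a * b * c * (a + b + c) := by
        exact_mod_cast h2
      rw [hα, hβ]
      linarith
    have hkM : ((2 * α * β - 1) ^ 2 - 4 * α ^ 2) / (4 * β) + α < k := by
      have h3 : ⌊((2 * α * β - 1) ^ 2 - 4 * α ^ 2) / (4 * β) + α⌋ < (k : ℤ) := by omega
      exact_mod_cast Int.floor_lt.1 h3
    have hαβ : 1 ≤ α * β := one_le_mul_of_one_le_of_one_le hα1 hβ1
    have hlow : ((2 * α * β - 1) / 2) ^ 2 < β * (k - α) + α ^ 2 := by
      rw [← lt_sub_iff_add_lt, div_lt_iff₀ (by positivity)] at hkM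
      linarith
    set U := Real.sqrt (β * ((k : ℝ) + α) + α ^ 2)
    set L := Real.sqrt (β * ((k : ℝ) - α) + α ^ 2)
    have hU2 : U ^ 2 = β * (k + α) + α ^ 2 := Real.sq_sqrt (by positivity)
    have hL2 : L ^ 2 = β * (k - α) + α ^ 2 :=
      Real.sq_sqrt ((sq_nonneg _).trans hlow.le)
    have htU : (t : ℝ) + α ≤ U := Real.le_sqrt_of_sq_le h1'
    have hLt : L < t + α := (Real.sqrt_lt' (by positivity)).2 h2'
    have hLlow : (2 * α * β - 1) / 2 < L := Real.lt_sqrt_of_sq_lt hlow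
    have hUL : U < L + 1 := by
      refine lt_of_pow_lt_pow_left₀ 2 (by linarith) ?_
      rw [add_sq, hL2, hU2]
      linarith
    have hγle : (t : ℤ) ≤ γ := by
      rw [hγ, Int.le_floor]
      push_cast
      linarith
    have hγlt : γ < (t : ℤ) + 1 := by
      rw [hγ, Int.floor_lt]
      push_cast
      linarith
    omega
  · intro ht
    rw [← hsol, ← ht, numSol]
    congr 1
    ext p
    simp only [Set.mem_ofPred_eq]
    norm_cast
end

section
/- Let a, b, c, n be positive integers with gcd(a,b,c) = 1. Let g_1 = gcd(b,c), g_2 = gcd(c,a), g_3 = gcd(a,b); let n_1 be the unique integer with 0 ≤ n_1 < g_1 and a·n_1 ≡ n (mod g_1), n_2 the unique integer with 0 ≤ n_2 < g_2 and b·n_2 ≡ n (mod g_2), and n_3 the unique integer with 0 ≤ n_3 < g_3 and c·n_3 ≡ n (mod g_3). Let A = a/(g_2 g_3), B = b/(g_3 g_1), C = c/(g_1 g_2). Then g_1 g_2 g_3 divides n − a·n_1 − b·n_2 − c·n_3, and, setting N = (n − a·n_1 − b·n_2 − c·n_3)/(g_1 g_2 g_3), the number of triples (x,y,z) of nonnegative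 integers with ax + by + cz = n equals the number of triples (x,y,z) of nonnegative integers with Ax + By + Cz = N. -/
/-- If `a * x ≡ a * m` modulo a natural number `g` coprime to `a`, and `m < g`, then
`x` is `m` plus a natural multiple of `g`. -/
theorem exists_eq_mul_add_of_dvd_sub {a g x m : ℕ} (hag : Nat.Coprime g a) (hm : m < g)
    (h : (g : ℤ) ∣ a * x - a * m) : ∃ q : ℕ, x = g * q + m := by
  rw [← mul_sub] at h
  have hx : (g : ℤ) ∣ x - m :=
    (Nat.isCoprime_iff_coprime.mpr hag).dvd_of_dvd_mul_left h
  have hmod : m % g = x % g := (Nat.modEq_iff_dvd.mpr hx)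
  rw [Nat.mod_eq_of_lt hm] at hmod
  exact ⟨x / g, by rw [hmod, Nat.div_add_mod]⟩

theorem stmt_8 (a b c n : ℕ)
    (ha : 0 < a) (hb : 0 < b) (hc : 0 < c) (hn : 0 < n)
    (habc : Nat.gcd (Nat.gcd a b) c = 1)
    (g1 g2 g3 : ℕ) (hg1 : g1 = Nat.gcd b c) (hg2 : g2 = Nat.gcd c a)
    (hg3 : g3 = Nat.gcd a b)
    (n1 n2 n3 : ℕ)
    (hn1 : n1 < g1 ∧ (g1 : ℤ) ∣ ((a : ℤ) * n1 - n))
    (hn2 : n2 < g2 ∧ (g2 : ℤ) ∣ ((b : ℤ) * n2 - n))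
    (hn3 : n3 < g3 ∧ (g3 : ℤ) ∣ ((c : ℤ) * n3 - n))
    (A B C : ℕ) (hA : A = a / (g2 * g3)) (hB : B = b / (g3 * g1))
    (hC : C = c / (g1 * g2)) :
    ((g1 : ℤ) * g2 * g3 ∣ (n : ℤ) - a * n1 - b * n2 - c * n3) ∧
    numSol a b c n =
      {p : ℕ × ℕ × ℕ | (A : ℤ) * p.1 + (B : ℤ) * p.2.1 + (C : ℤ) * p.2.2 =
        ((n : ℤ) - a * n1 - b * n2 - c * n3) / ((g1 : ℤ) * g2 * g3)}.ncard := by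
  have unit_of_dvd : ∀ d : ℕ, d ∣ a → d ∣ b → d ∣ c → d = 1 := fun d h1 h2 h3 =>
    Nat.dvd_one.mp (habc ▸ Nat.dvd_gcd (Nat.dvd_gcd h1 h2) h3)
  have g1b : g1 ∣ b := hg1 ▸ Nat.gcd_dvd_left b c
  have g1c : g1 ∣ c := hg1 ▸ Nat.gcd_dvd_right b c
  have g2c : g2 ∣ c := hg2 ▸ Nat.gcd_dvd_left c a
  have g2a : g2 ∣ a := hg2 ▸ Nat.gcd_dvd_right c a
  have g3a : g3 ∣ a := hg3 ▸ Nat.gcd_dvd_left a b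
  have g3b : g3 ∣ b := hg3 ▸ Nat.gcd_dvd_right a b
  have c1a : Nat.Coprime g1 a :=
    unit_of_dvd _ (Nat.gcd_dvd_right _ _) ((Nat.gcd_dvd_left _ _).trans g1b)
      ((Nat.gcd_dvd_left _ _).trans g1c)
  have c2b : Nat.Coprime g2 b :=
    unit_of_dvd _ ((Nat.gcd_dvd_left _ _).trans g2a) (Nat.gcd_dvd_right _ _)
      ((Nat.gcd_dvd_left _ _).trans g2c)
  have c3c : Nat.Coprime g3 c :=
    unit_of_dvd _ ((Nat.gcd_dvd_left _ _).trans g3a) ((Nat.gcd_dvd_left _ _).trans g3b)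
      (Nat.gcd_dvd_right _ _)
  have c12 : Nat.Coprime g1 g2 := c1a.coprime_dvd_right g2a
  have c13 : Nat.Coprime g1 g3 := c1a.coprime_dvd_right g3a
  have c23 : Nat.Coprime g2 g3 := c2b.coprime_dvd_right g3b
  have ea : a = g2 * g3 * A := by
    rw [hA, Nat.mul_div_cancel' (c23.mul_dvd_of_dvd_of_dvd g2a g3a)]
  have eb : b = g3 * g1 * B := by
    rw [hB, Nat.mul_div_cancel' (c13.symm.mul_dvd_of_dvd_of_dvd g3b g1b)]
  have ec : c = g1 * g2 * C := by
    rw [hC, Nat.mul_div_cancel' (c12.mul_dvd_of_dvd_of_dvd g1c g2c)]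
  obtain ⟨l1, d1⟩ := hn1
  obtain ⟨l2, d2⟩ := hn2
  obtain ⟨l3, d3⟩ := hn3
  have z1b := Int.natCast_dvd_natCast.mpr g1b
  have z1c := Int.natCast_dvd_natCast.mpr g1c
  have z2c := Int.natCast_dvd_natCast.mpr g2c
  have z2a := Int.natCast_dvd_natCast.mpr g2a
  have z3a := Int.natCast_dvd_natCast.mpr g3a
  have z3b := Int.natCast_dvd_natCast.mpr g3b
  have hdvd : (g1 : ℤ) * g2 * g3 ∣ (n : ℤ) - a * n1 - b * n2 - c * n3 := by
    refine IsCoprime.mul_dvd ?_ (IsCoprime.mul_dvd ?_ ?_ ?_) ?_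
    · exact_mod_cast Nat.isCoprime_iff_coprime.mpr (c13.mul_left c23)
    · exact Nat.isCoprime_iff_coprime.mpr c12
    · have := ((d1.neg_right).sub (z1b.mul_right n2)).sub (z1c.mul_right n3)
      rwa [neg_sub] at this
    · refine (((d2.neg_right).sub (z2a.mul_right n1)).sub (z2c.mul_right n3)).trans (dvd_of_eq ?_)
      ring
    · refine (((d3.neg_right).sub (z3a.mul_right n1)).sub (z3b.mul_right n2)).trans (dvd_of_eq ?_)
      ring
  refine ⟨hdvd, ?_⟩
  obtain ⟨N, hN⟩ := hdvd
  have p1 : 0 < g1 := by omega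
  have p2 : 0 < g2 := by omega
  have p3 : 0 < g3 := by omega
  have hG : (g1 : ℤ) * g2 * g3 ≠ 0 := by positivity
  rw [hN, Int.mul_ediv_cancel_left _ hG]
  let f : ℕ × ℕ × ℕ → ℕ × ℕ × ℕ := fun p => (g1 * p.1 + n1, g2 * p.2.1 + n2, g3 * p.2.2 + n3)
  have hf : Function.Injective f := by
    rintro ⟨x, y, z⟩ ⟨x', y', z'⟩ h
    simpa [f, p1.ne', p2.ne', p3.ne'] using h
  have key : ∀ p : ℕ × ℕ × ℕ, a * (f p).1 + b * (f p).2.1 + c * (f p).2.2 = n ↔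
      (A : ℤ) * p.1 + (B : ℤ) * p.2.1 + (C : ℤ) * p.2.2 = N := by
    rintro ⟨x, y, z⟩
    have za : (a : ℤ) = g2 * g3 * A := by exact_mod_cast ea
    have zb : (b : ℤ) = g3 * g1 * B := by exact_mod_cast eb
    have zc : (c : ℤ) = g1 * g2 * C := by exact_mod_cast ec
    rw [← Int.natCast_inj, ← mul_right_inj' (b := (A : ℤ) * _ + B * _ + C * _) hG, ← hN]
    simp only [f]
    push_cast
    constructor <;> intro h
    · linear_combination h - x * g1 * za - y * g2 * zb - z * g3 * zc
    · linear_combination h + x * g1 * za + y * g2 * zb + z * g3 * zc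
  rw [numSol, ← Set.ncard_image_of_injective
    {p : ℕ × ℕ × ℕ | (A : ℤ) * p.1 + (B : ℤ) * p.2.1 + (C : ℤ) * p.2.2 = N} hf]
  congr 1
  ext ⟨x, y, z⟩
  simp only [Set.mem_image, Set.mem_ofPred_eq]
  constructor
  · intro h
    have hz : (a : ℤ) * x + b * y + c * z = n := by exact_mod_cast h
    have e1 : (g1 : ℤ) ∣ a * x - a * n1 :=
      (((d1.neg_right).sub (z1b.mul_right y)).sub (z1c.mul_right z)).trans
        (dvd_of_eq (by linear_combination -hz))
    have e2 : (g2 : ℤ) ∣ b * y - b * n2 :=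
      (((d2.neg_right).sub (z2a.mul_right x)).sub (z2c.mul_right z)).trans
        (dvd_of_eq (by linear_combination -hz))
    have e3 : (g3 : ℤ) ∣ c * z - c * n3 :=
      (((d3.neg_right).sub (z3a.mul_right x)).sub (z3b.mul_right y)).trans
        (dvd_of_eq (by linear_combination -hz))
    obtain ⟨x', rfl⟩ := exists_eq_mul_add_of_dvd_sub c1a l1 e1
    obtain ⟨y', rfl⟩ := exists_eq_mul_add_of_dvd_sub c2b l2 e2
    obtain ⟨z', rfl⟩ := exists_eq_mul_add_of_dvd_sub c3c l3 e3
    exact ⟨(x', y', z'), (key (x', y', z')).mp h, rfl⟩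
  · rintro ⟨p, hp, hfp⟩
    simpa only [hfp] using (key p).mpr hp
end

section
/- Let a, b, c be positive integers with gcd(a,b,c) = 1. Let g_1 = gcd(b,c), g_2 = gcd(c,a), g_3 = gcd(a,b), A = a/(g_2 g_3), B = b/(g_3 g_1), C = c/(g_1 g_2). Set α' = (A+B+C)/2, β' = 2ABC, M' = ⌊((2α'β'−1)² − 4α'²)/(4β') + α'⌋ + 1, γ'_k = ⌊√(β'(k+α') + α'²) − α'⌋ and δ'_k = ⌊√(β'(k−α') + α'²) − α'⌋. Suppose k ≥ M', γ'_k ≠ δ'_k, and the equation Ax + By + Cz = γ'_k has exactly k nonnegative integer solutions. Then R_k(a,b,c) = { g_1 g_2 g_3 · γ'_k + a·i_1 + b·i_2 + c·i_3 : 0 ≤ i_1 ≤ g_1 − 1, 0 ≤ i_2 ≤ g_2 − 1, 0 ≤ i_3 ≤ g_3 − 1 }. -/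
open Finset in
/-- Partial sums of an integer sequence whose sums over windows of length `m` vanish. -/
theorem two_mul_abs_sum_range_le (m : ℕ) (e : ℕ → ℤ) (hm : 0 < m)
    (he : ∀ z, |e z| ≤ (m : ℤ) - 1)
    (hz : ∀ L, ∑ z ∈ range m, e (L + z) = 0) (L : ℕ) :
    2 * |∑ z ∈ range L, e z| ≤ (m : ℤ) * (m - 1) := by
  have bound : ∀ (s l : ℕ), |∑ z ∈ range l, e (s + z)| ≤ (l : ℤ) * (m - 1) := by
    intro s l
    refine (abs_sum_le_sum_abs _ _).trans ?_
    refine (sum_le_card_nsmul _ _ _ fun z _ => he (s + z)).trans ?_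
    simp
  have hm1 : (1 : ℤ) ≤ m := by exact_mod_cast hm
  induction L using Nat.strong_induction_on with
  | _ L ih =>
    by_cases hL : m ≤ L
    · obtain ⟨d, rfl⟩ := Nat.exists_eq_add_of_le' hL
      rw [sum_range_add, hz, add_zero]
      exact ih d (by omega)
    · by_cases h2 : 2 * L ≤ m
      · have h := bound 0 L
        simp only [zero_add] at h
        have h2' : 2 * (L : ℤ) ≤ m := by exact_mod_cast h2
        nlinarith
      · obtain ⟨d, rfl⟩ := Nat.exists_eq_add_of_le (Nat.le_of_not_le hL)
        have h := bound L d
        have h0 := hz 0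
        simp only [zero_add] at h0
        rw [sum_range_add] at h0
        rw [eq_neg_of_add_eq_zero_left h0, abs_neg]
        have h2' : 2 * (d : ℤ) ≤ (L + d : ℕ) := by omega
        nlinarith

open Finset in
theorem sum_two_mul_sub_eq_zero (m : ℕ) (w : ℕ → ℕ) (hlt : ∀ z, w z < m)
    (hinj : ∀ y z, w y = w z → y ≡ z [MOD m]) (L : ℕ) :
    ∑ z ∈ range m, (2 * (w (L + z) : ℤ) - (m - 1)) = 0 := by
  have hio : Set.InjOn (fun z => w (L + z)) (range m) := by
    intro y hy z hz hyz
    simp only [coe_range, Set.mem_Iio] at hy hz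
    have h := Nat.ModEq.add_left_cancel' L (hinj _ _ hyz)
    exact Nat.ModEq.eq_of_lt_of_lt h hy hz
  have him : (range m).image (fun z => w (L + z)) = range m := by
    apply eq_of_subset_of_card_le
    · intro x hx
      obtain ⟨z, -, rfl⟩ := mem_image.1 hx
      exact mem_range.2 (hlt _)
    · rw [card_image_of_injOn hio]
  have hs : ∑ z ∈ range m, w (L + z) = ∑ i ∈ range m, i := by
    conv_rhs => rw [← him]
    rw [sum_image hio]
  rcases Nat.eq_zero_or_pos m with rfl | hm
  · simp
  have h2 := sum_range_id_mul_two m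
  rw [← hs] at h2
  have h3 : (∑ z ∈ range m, (w (L + z) : ℤ)) * 2 = m * (m - 1) := by
    have := congrArg (Nat.cast : ℕ → ℤ) h2
    push_cast [Nat.cast_sub (show 1 ≤ m from hm)] at this
    exact this
  rw [sum_sub_distrib, ← mul_sum]
  simp only [sum_const, card_range, nsmul_eq_mul]
  linarith

/-- The residue `u < m` with `p * u ≡ s` modulo `m`, for `p` coprime to `m`. -/
theorem exists_residue (m p : ℕ) (hm : 0 < m) (hp : Nat.Coprime p m) (s : ℕ) :
    ∃ u < m, p * u ≡ s [MOD m] :=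
  Nat.exists_mul_mod_eq_of_coprime s hp hm.ne'

/-- Popoviciu's formula for the number of solutions of `A x + B y = s`. -/
theorem mul_ncard_two_eq (A B : ℕ) (hA : 0 < A) (hB : 0 < B) (hAB : Nat.Coprime A B)
    (s u v : ℕ) (hu : u < B) (hv : v < A)
    (hus : A * u ≡ s [MOD B]) (hvs : B * v ≡ s [MOD A]) :
    (A * B : ℤ) * ({p : ℕ × ℕ | A * p.1 + B * p.2 = s}.ncard : ℤ)
      = s - A * u - B * v + A * B := by
  have d1 : (B : ℤ) ∣ s - A * u - B * v := by
    have := (Nat.modEq_iff_dvd.1 hus)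
    push_cast at this
    exact dvd_sub this (dvd_mul_right _ _)
  have d2 : (A : ℤ) ∣ s - A * u - B * v := by
    have := (Nat.modEq_iff_dvd.1 hvs)
    push_cast at this
    rw [show (s : ℤ) - A * u - B * v = (s - B * v) - A * u by ring]
    exact dvd_sub this (dvd_mul_right _ _)
  obtain ⟨q, hq⟩ := IsCoprime.mul_dvd (Nat.isCoprime_iff_coprime.2 hAB) d2 d1
  have hA' : (0 : ℤ) < A := by exact_mod_cast hA
  have hB' : (0 : ℤ) < B := by exact_mod_cast hB
  have hu' : (u : ℤ) + 1 ≤ B := by exact_mod_cast hu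
  have hv' : (v : ℤ) + 1 ≤ A := by exact_mod_cast hv
  have hP : (0 : ℤ) < A * B := by positivity
  have hq1 : -2 < q := by
    by_contra! h
    nlinarith [mul_le_mul_of_nonneg_left h hP.le, mul_le_mul_of_nonneg_left hu' hA'.le,
      mul_le_mul_of_nonneg_left hv' hB'.le]
  have key : {p : ℕ × ℕ | A * p.1 + B * p.2 = s} =
      (fun p : ℕ × ℕ => (u + B * p.1, v + A * p.2)) ''
        {p : ℕ × ℕ | (p.1 : ℤ) + p.2 = q} := by
    ext ⟨x, y⟩
    simp only [Set.mem_ofPred_eq, Set.mem_image, Prod.mk.injEq, Prod.exists]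
    constructor
    · intro h
      have hx : x ≡ u [MOD B] := by
        apply Nat.ModEq.cancel_left_of_coprime (c := A) hAB.symm
        refine Nat.ModEq.trans ?_ hus.symm
        rw [← h]
        exact (Nat.ModEq.symm (by simp [Nat.ModEq]))
      have hy : y ≡ v [MOD A] := by
        apply Nat.ModEq.cancel_left_of_coprime (c := B) hAB
        refine Nat.ModEq.trans ?_ hvs.symm
        rw [← h]
        exact (Nat.ModEq.symm (by simp [Nat.ModEq]))
      have hx2 : u + B * (x / B) = x := by
        have : x % B = u := by rw [hx, Nat.mod_eq_of_lt hu]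
        rw [← this]; exact Nat.mod_add_div x B
      have hy2 : v + A * (y / A) = y := by
        have : y % A = v := by rw [hy, Nat.mod_eq_of_lt hv]
        rw [← this]; exact Nat.mod_add_div y A
      refine ⟨x / B, y / A, ?_, hx2, hy2⟩
      apply mul_left_cancel₀ hP.ne'
      rw [← hq, ← h]
      generalize x / B = i at hx2
      generalize y / A = j at hy2
      subst hx2 hy2
      push_cast
      ring
    · rintro ⟨i, j, hij, rfl, rfl⟩
      zify
      rw [← hij] at hq
      linarith
  rw [key, Set.ncard_image_of_injective]
  · by_cases h : q = -1
    · have : {p : ℕ × ℕ | (p.1 : ℤ) + p.2 = q} = ∅ := by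
        ext p
        simp only [Set.mem_ofPred_eq, Set.mem_empty_iff_false, iff_false]
        omega
      rw [this, hq, h]
      simp
    · obtain ⟨n, rfl⟩ := Int.eq_ofNat_of_zero_le (show 0 ≤ q by omega)
      have : {p : ℕ × ℕ | (p.1 : ℤ) + p.2 = n} = (Finset.HasAntidiagonal.antidiagonal n : Set (ℕ × ℕ)) := by
        ext p
        simp only [Set.mem_ofPred_eq, Finset.mem_coe, Finset.HasAntidiagonal.mem_antidiagonal]
        omega
      rw [this, hq, Set.ncard_coe_finset, Finset.Nat.card_antidiagonal]
      push_cast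
      ring
  · rintro ⟨x, y⟩ ⟨x', y'⟩ h
    simp only [Prod.mk.injEq, add_right_inj, mul_eq_mul_left_iff] at h ⊢
    omega

open Finset in
theorem numSol_eq_sum_s9 (A B C n r : ℕ) (hA : 0 < A) (hB : 0 < B) (hr : r < C) :
    numSol A B C (C * n + r) =
      ∑ j ∈ range (n + 1), {p : ℕ × ℕ | A * p.1 + B * p.2 = r + C * j}.ncard := by
  have fin : ∀ s, {p : ℕ × ℕ | A * p.1 + B * p.2 = s}.Finite := by
    intro s
    apply ((range (s + 1) ×ˢ range (s + 1)).finite_toSet).subset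
    rintro ⟨x, y⟩ h
    simp only [Set.mem_ofPred_eq] at h
    simp only [coe_product, coe_range, Set.mem_prod, Set.mem_Iio]
    constructor <;> nlinarith
  have key : {p : ℕ × ℕ × ℕ | A * p.1 + B * p.2.1 + C * p.2.2 = C * n + r} =
      (((range (n + 1)).biUnion fun j =>
        (fin (r + C * j)).toFinset.image fun p => (p.1, p.2, n - j) : Finset (ℕ × ℕ × ℕ)) :
          Set (ℕ × ℕ × ℕ)) := by
    ext ⟨x, y, z⟩
    simp only [Set.mem_ofPred_eq, coe_biUnion, coe_image, Set.mem_iUnion, Set.mem_image,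
      Set.Finite.coe_toFinset, Prod.mk.injEq, Prod.exists, mem_coe, mem_range, exists_prop]
    constructor
    · intro h
      have hz : z ≤ n := by
        by_contra! hz
        nlinarith [Nat.mul_le_mul_left C hz]
      refine ⟨n - z, by omega, x, y, ?_, rfl, rfl, by omega⟩
      obtain ⟨d, rfl⟩ := Nat.exists_eq_add_of_le hz
      rw [Nat.add_sub_cancel_left]
      linarith
    · rintro ⟨j, hj, x', y', h, rfl, rfl, rfl⟩
      obtain ⟨d, rfl⟩ := Nat.exists_eq_add_of_le (Nat.le_of_lt_succ hj)
      rw [Nat.add_sub_cancel_left]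
      linarith
  rw [numSol, key, Set.ncard_coe_finset, card_biUnion]
  · refine sum_congr rfl fun j _ => ?_
    rw [card_image_of_injective, Set.ncard_eq_toFinset_card _ (fin _)]
    rintro ⟨x, y⟩ ⟨x', y'⟩ h
    simp only [Prod.mk.injEq] at h ⊢
    exact ⟨h.1, h.2.1⟩
  · intro i hi j hj hij
    simp only [coe_range, Set.mem_Iio] at hi hj
    rw [Function.onFun, disjoint_left]
    rintro ⟨x, y, z⟩ h1 h2
    simp only [mem_image, Prod.mk.injEq] at h1 h2
    obtain ⟨_, _, _, _, h1⟩ := h1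
    obtain ⟨_, _, _, _, h2⟩ := h2
    omega

/-- The counting function of `A x + B y + C z = t` differs from
`(t ^ 2 + (A + B + C) * t) / (2 * A * B * C)` by at most `(A + B + C) / 2`. -/
theorem numSol_bounds_s9 (A B C : ℕ) (hA : 0 < A) (hB : 0 < B) (hC : 0 < C)
    (hAB : Nat.Coprime A B) (hBC : Nat.Coprime B C) (hCA : Nat.Coprime C A) (t : ℕ) :
    (t ^ 2 + (A + B + C) * t - (A + B + C) * (A * B * C) : ℤ) ≤
        2 * (A * B * C) * (numSol A B C t : ℤ) ∧
      2 * (A * B * C) * (numSol A B C t : ℤ) <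
        (t ^ 2 + (A + B + C) * t + (A + B + C) * (A * B * C) : ℤ) := by
  choose u hu hus using exists_residue B A hB hAB
  choose v hv hvs using exists_residue A B hA hAB.symm
  obtain ⟨n, r, hr, rfl⟩ : ∃ n r, r < C ∧ C * n + r = t :=
    ⟨t / C, t % C, Nat.mod_lt _ hC, Nat.div_add_mod t C⟩
  have partial_sum : ∀ (m p : ℕ) (w : ℕ → ℕ), 0 < m → Nat.Coprime C m →
      (∀ s, w s < m) → (∀ s, p * w s ≡ s [MOD m]) →
      2 * |∑ j ∈ Finset.range (n + 1), (2 * (w (r + C * j) : ℤ) - (m - 1))| ≤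
        (m : ℤ) * (m - 1) := by
    intro m p w hm hCm hw hws
    refine two_mul_abs_sum_range_le m (fun j => 2 * (w (r + C * j) : ℤ) - (m - 1)) hm ?_ ?_ _
    · intro z
      have := hw (r + C * z)
      rw [abs_le]
      constructor <;> omega
    · intro L
      refine sum_two_mul_sub_eq_zero m (fun j => w (r + C * j)) (fun z => hw _) ?_ L
      intro y z hyz
      have h : r + C * y ≡ r + C * z [MOD m] :=
        (hws _).symm.trans ((congrArg (fun i => p * i) hyz : _ = _) ▸ hws _)
      exact Nat.ModEq.cancel_left_of_coprime hCm.symm (Nat.ModEq.add_left_cancel' r h)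
  have hE := partial_sum B A u hB hBC.symm hu hus
  have hF := partial_sum A B v hA hCA hv hvs
  set E := ∑ j ∈ Finset.range (n + 1), (2 * (u (r + C * j) : ℤ) - (B - 1)) with hEdef
  set F := ∑ j ∈ Finset.range (n + 1), (2 * (v (r + C * j) : ℤ) - (A - 1)) with hFdef
  have hgauss : (∑ j ∈ Finset.range (n + 1), (j : ℤ)) * 2 = (n + 1) * n := by
    have := congrArg (Nat.cast : ℕ → ℤ) (Finset.sum_range_id_mul_two (n + 1))
    rw [Nat.add_sub_cancel] at this
    push_cast at this
    exact this
  have hN : 2 * (A * B : ℤ) * (numSol A B C (C * n + r) : ℤ) =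
      (n + 1) * (2 * r + C * n + A + B) - A * E - B * F := by
    rw [numSol_eq_sum_s9 A B C n r hA hB hr]
    have h1 : ∀ j : ℕ, 2 * (A * B : ℤ) *
        ({p : ℕ × ℕ | A * p.1 + B * p.2 = r + C * j}.ncard : ℤ) =
        (2 * r + A + B) + (2 * C) * j - A * (2 * (u (r + C * j) : ℤ) - (B - 1))
          - B * (2 * (v (r + C * j) : ℤ) - (A - 1)) := by
      intro j
      have := mul_ncard_two_eq A B hA hB hAB (r + C * j) (u (r + C * j)) (v (r + C * j))
        (hu _) (hv _) (hus _) (hvs _)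
      push_cast at this
      linear_combination 2 * this
    push_cast
    rw [Finset.mul_sum, Finset.sum_congr rfl fun j _ => h1 j, Finset.sum_sub_distrib,
      Finset.sum_sub_distrib, Finset.sum_add_distrib, ← Finset.mul_sum, ← Finset.mul_sum,
      ← Finset.mul_sum, ← hEdef, ← hFdef]
    simp only [Finset.sum_const, Finset.card_range, nsmul_eq_mul]
    push_cast
    linear_combination (C : ℤ) * hgauss
  generalize numSol A B C (C * n + r) = N at hN
  clear_value E F
  have hA' : (1 : ℤ) ≤ A := by exact_mod_cast hA
  have hB' : (1 : ℤ) ≤ B := by exact_mod_cast hB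
  have hC' : (1 : ℤ) ≤ C := by exact_mod_cast hC
  have hr' : (r : ℤ) + 1 ≤ C := by exact_mod_cast hr
  have hr0 : (0 : ℤ) ≤ r := by positivity
  have hdiff : 2 * (A * B * C : ℤ) * N =
      ((C * n + r : ℕ) : ℤ) ^ 2 + (A + B + C) * ((C * n + r : ℕ) : ℤ)
        + (C - r) * (r + A + B) - C * (A * E + B * F) := by
    push_cast
    linear_combination (C : ℤ) * hN
  rw [hdiff]
  generalize ((C * n + r : ℕ) : ℤ) = T
  generalize (A : ℤ) = a at *
  generalize (B : ℤ) = b at *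
  generalize (C : ℤ) = c at *
  generalize (r : ℤ) = ρ at *
  clear hN hdiff partial_sum
  have hE1 := le_abs_self E
  have hE2 := neg_abs_le E
  have hF1 := le_abs_self F
  have hF2 := neg_abs_le F
  have ha0 : 0 ≤ a := by linarith
  have hb0 : 0 ≤ b := by linarith
  have hEl := mul_le_mul_of_nonneg_left hE ha0
  have hFl := mul_le_mul_of_nonneg_left hF hb0
  have hEF1 : 2 * (a * E + b * F) ≤ a * b * (a + b - 2) := by
    linarith [mul_le_mul_of_nonneg_left hE1 ha0, mul_le_mul_of_nonneg_left hF1 hb0]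
  have hEF2 : -(a * b * (a + b - 2)) ≤ 2 * (a * E + b * F) := by
    linarith [mul_le_mul_of_nonneg_left hE2 ha0, mul_le_mul_of_nonneg_left hF2 hb0]
  have hab : 1 ≤ a * b := by nlinarith
  have habS : a * b * (a + b - 2) ≤ 2 * ((a + b + c) * (a * b - 1)) := by
    rcases hab.eq_or_lt with h | h
    · have ha1 : a = 1 := Int.eq_one_of_mul_eq_one_right ha0 h.symm
      have hb1 : b = 1 := Int.eq_one_of_mul_eq_one_left hb0 h.symm
      rw [ha1, hb1]
      norm_num
    · have h2 : a * b ≤ 2 * (a * b - 1) := by linarith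
      have h3 := mul_le_mul_of_nonneg_right h2 (by linarith : 0 ≤ a + b - 2)
      have h4 := mul_nonneg (by linarith : 0 ≤ a * b - 1) (by linarith : 0 ≤ c + 2)
      nlinarith
  have hlow : 0 ≤ (c - ρ) * (ρ + a + b) := mul_nonneg (by linarith) (by linarith)
  have hhigh : (c - ρ) * (ρ + a + b) < c * (a + b + c) :=
    mul_lt_mul' (by linarith) (by linarith) (by linarith) (by linarith)
  have hc1 := mul_le_mul_of_nonneg_left hEF1 (by linarith : 0 ≤ c)
  have hc2 := mul_le_mul_of_nonneg_left hEF2 (by linarith : 0 ≤ c)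
  have hc3 := mul_le_mul_of_nonneg_left habS (by linarith : 0 ≤ c)
  have hS : 0 ≤ c * (a + b + c) := by positivity
  constructor <;> linarith

/-- Fixing the residues of the three unknowns modulo the pairwise gcds `g1`, `g2`, `g3`
reduces the equation to one with pairwise coprime coefficients. -/
theorem numSol_eq_ncard_reduced (A B C g1 g2 g3 : ℕ) (hg1 : 0 < g1) (hg2 : 0 < g2) (hg3 : 0 < g3)
    (h1 : Nat.Coprime (g2 * g3 * A) g1) (h2 : Nat.Coprime (g3 * g1 * B) g2)
    (h3 : Nat.Coprime (g1 * g2 * C) g3) (t i1 i2 i3 : ℕ) (q : ℤ)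
    (hi1 : i1 < g1) (hi2 : i2 < g2) (hi3 : i3 < g3)
    (ht : (t : ℤ) = (g1 : ℤ) * g2 * g3 * q + (g2 * g3 * A : ℕ) * i1 + (g3 * g1 * B : ℕ) * i2
      + (g1 * g2 * C : ℕ) * i3) :
    numSol (g2 * g3 * A) (g3 * g1 * B) (g1 * g2 * C) t =
      {p : ℕ × ℕ × ℕ | (A : ℤ) * p.1 + (B : ℤ) * p.2.1 + (C : ℤ) * p.2.2 = q}.ncard := by
  have hG : ((g1 : ℤ) * g2 * g3) ≠ 0 := by positivity
  have residue : ∀ (g a x i : ℕ), i < g → Nat.Coprime a g → (g : ℤ) ∣ a * x - a * i →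
      i + g * (x / g) = x := by
    intro g a x i hi hag hd
    have : i ≡ x [MOD g] := by
      apply Nat.ModEq.cancel_left_of_coprime (c := a) hag.symm
      apply Nat.modEq_iff_dvd.2
      exact_mod_cast hd
    have : x % g = i := by rw [← this, Nat.mod_eq_of_lt hi]
    rw [← this]; exact Nat.mod_add_div x g
  refine (congrArg Set.ncard ?_).trans (Set.ncard_image_of_injective
    (f := fun p : ℕ × ℕ × ℕ => (i1 + g1 * p.1, i2 + g2 * p.2.1, i3 + g3 * p.2.2)) _ ?_)
  · ext ⟨x, y, z⟩
    simp only [Set.mem_ofPred_eq, Set.mem_image, Prod.mk.injEq, Prod.exists]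
    constructor
    · intro h
      have h' : ((g2 * g3 * A : ℕ) : ℤ) * x + (g3 * g1 * B : ℕ) * y + (g1 * g2 * C : ℕ) * z = t := by
        exact_mod_cast h
      rw [ht] at h'
      have hx := residue g1 _ x i1 hi1 h1
        ⟨g2 * g3 * q + g3 * B * i2 + g2 * C * i3 - g3 * B * y - g2 * C * z, by
          push_cast at h' ⊢; linear_combination h'⟩
      have hy := residue g2 _ y i2 hi2 h2
        ⟨g1 * g3 * q + g3 * A * i1 + g1 * C * i3 - g3 * A * x - g1 * C * z, by
          push_cast at h' ⊢; linear_combination h'⟩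
      have hz := residue g3 _ z i3 hi3 h3
        ⟨g1 * g2 * q + g2 * A * i1 + g1 * B * i2 - g2 * A * x - g1 * B * y, by
          push_cast at h' ⊢; linear_combination h'⟩
      refine ⟨x / g1, y / g2, z / g3, ?_, hx, hy, hz⟩
      generalize x / g1 = x' at hx
      generalize y / g2 = y' at hy
      generalize z / g3 = z' at hz
      subst hx hy hz
      apply mul_left_cancel₀ hG
      push_cast at h' ⊢
      linear_combination h'
    · rintro ⟨x', y', z', h, rfl, rfl, rfl⟩
      zify
      rw [ht, ← h]
      push_cast
      ring
  · rintro ⟨x, y, z⟩ ⟨x', y', z'⟩ h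
    simp only [Prod.mk.injEq, add_right_inj, mul_eq_mul_left_iff] at h ⊢
    omega

theorem exists_residues (A B C g1 g2 g3 : ℕ) (hg1 : 0 < g1) (hg2 : 0 < g2) (hg3 : 0 < g3)
    (h1 : Nat.Coprime (g2 * g3 * A) g1) (h2 : Nat.Coprime (g3 * g1 * B) g2)
    (h3 : Nat.Coprime (g1 * g2 * C) g3) (t : ℕ) :
    ∃ (i1 i2 i3 : ℕ) (q : ℤ), i1 < g1 ∧ i2 < g2 ∧ i3 < g3 ∧
      (t : ℤ) = (g1 : ℤ) * g2 * g3 * q + (g2 * g3 * A : ℕ) * i1 + (g3 * g1 * B : ℕ) * i2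
        + (g1 * g2 * C : ℕ) * i3 := by
  obtain ⟨i1, hi1, e1⟩ := exists_residue g1 _ hg1 h1 t
  obtain ⟨i2, hi2, e2⟩ := exists_residue g2 _ hg2 h2 t
  obtain ⟨i3, hi3, e3⟩ := exists_residue g3 _ hg3 h3 t
  have h12 : IsCoprime (g1 : ℤ) g2 := Nat.isCoprime_iff_coprime.2
    (h2.coprime_dvd_left ⟨g3 * B, by ring⟩)
  have h13 : IsCoprime (g1 : ℤ) g3 := Nat.isCoprime_iff_coprime.2
    (h3.coprime_dvd_left ⟨g2 * C, by ring⟩)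
  have h23 : IsCoprime (g2 : ℤ) g3 := Nat.isCoprime_iff_coprime.2
    (h3.coprime_dvd_left ⟨g1 * C, by ring⟩)
  obtain ⟨q1, d1⟩ := Nat.modEq_iff_dvd.1 e1
  obtain ⟨q2, d2⟩ := Nat.modEq_iff_dvd.1 e2
  obtain ⟨q3, d3⟩ := Nat.modEq_iff_dvd.1 e3
  set X : ℤ := t - ((g2 * g3 * A : ℕ) * i1 + (g3 * g1 * B : ℕ) * i2 + (g1 * g2 * C : ℕ) * i3)
    with hX
  obtain ⟨q, hq⟩ : (g1 : ℤ) * g2 * g3 ∣ X := by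
    refine IsCoprime.mul_dvd (IsCoprime.mul_left h13 h23) (IsCoprime.mul_dvd h12 ?_ ?_) ?_
    · exact ⟨q1 - g3 * B * i2 - g2 * C * i3, by push_cast at *; linear_combination d1 + hX⟩
    · exact ⟨q2 - g3 * A * i1 - g1 * C * i3, by push_cast at *; linear_combination d2 + hX⟩
    · exact ⟨q3 - g2 * A * i1 - g1 * B * i2, by push_cast at *; linear_combination d3 + hX⟩
  exact ⟨i1, i2, i3, q, hi1, hi2, hi3, by linarith⟩

/-- Decomposition of three coefficients along their pairwise gcds. -/
theorem exists_gcd_decomposition (a b c : ℕ) (ha : 0 < a)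
    (habc : Nat.gcd (Nat.gcd a b) c = 1) (g1 g2 g3 : ℕ) (hg1 : g1 = Nat.gcd b c)
    (hg2 : g2 = Nat.gcd c a) (hg3 : g3 = Nat.gcd a b) :
    a = g2 * g3 * (a / (g2 * g3)) ∧ Nat.Coprime a g1 ∧
      Nat.Coprime (a / (g2 * g3)) (b / (g3 * g1)) := by
  have gcd_dvd_one : ∀ d, d ∣ a → d ∣ b → d ∣ c → d ∣ 1 := fun d h1 h2 h3 =>
    habc ▸ Nat.dvd_gcd (Nat.dvd_gcd h1 h2) h3
  have d1b : g1 ∣ b := hg1 ▸ Nat.gcd_dvd_left _ _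
  have d1c : g1 ∣ c := hg1 ▸ Nat.gcd_dvd_right _ _
  have d2c : g2 ∣ c := hg2 ▸ Nat.gcd_dvd_left _ _
  have d2a : g2 ∣ a := hg2 ▸ Nat.gcd_dvd_right _ _
  have d3a : g3 ∣ a := hg3 ▸ Nat.gcd_dvd_left _ _
  have d3b : g3 ∣ b := hg3 ▸ Nat.gcd_dvd_right _ _
  have h23 : Nat.Coprime g2 g3 := Nat.dvd_one.1 <| gcd_dvd_one _
    ((Nat.gcd_dvd_left _ _).trans d2a) ((Nat.gcd_dvd_right _ _).trans d3b)
    ((Nat.gcd_dvd_left _ _).trans d2c)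
  have h31 : Nat.Coprime g3 g1 := Nat.dvd_one.1 <| gcd_dvd_one _
    ((Nat.gcd_dvd_left _ _).trans d3a) ((Nat.gcd_dvd_left _ _).trans d3b)
    ((Nat.gcd_dvd_right _ _).trans d1c)
  have ea := (Nat.mul_div_cancel' (h23.mul_dvd_of_dvd_of_dvd d2a d3a)).symm
  have eb := (Nat.mul_div_cancel' (h31.mul_dvd_of_dvd_of_dvd d3b d1b)).symm
  refine ⟨ea, ?_, ?_⟩
  · exact Nat.dvd_one.1 <| gcd_dvd_one _ (Nat.gcd_dvd_left _ _)
      ((Nat.gcd_dvd_right _ _).trans d1b) ((Nat.gcd_dvd_right _ _).trans d1c)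
  · have hg3pos : 0 < g3 := hg3 ▸ Nat.gcd_pos_of_pos_left _ ha
    generalize a / (g2 * g3) = A at *
    generalize b / (g3 * g1) = B at *
    have h : g3 * Nat.gcd A B ∣ g3 * 1 := by
      rw [mul_one]
      conv_rhs => rw [hg3]
      apply Nat.dvd_gcd
      · rw [ea]
        exact (mul_dvd_mul_left g3 (Nat.gcd_dvd_left A B)).trans ⟨g2, by ring⟩
      · rw [eb]
        exact (mul_dvd_mul_left g3 (Nat.gcd_dvd_right A B)).trans ⟨g1, by ring⟩
    exact Nat.dvd_one.1 (Nat.dvd_of_mul_dvd_mul_left hg3pos h)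

/-- For large `k`, an integer `q` with `|(q ^ 2 + 2 * α * q) / β - k| ≤ α` (strictly on one
side) is determined by `k`. -/
theorem eq_floor_of_bounds (α β k : ℝ) (hα : 1 ≤ 2 * α) (hβ : 1 ≤ β)
    (hk : ((2 * α * β - 1) ^ 2 - 4 * α ^ 2) / (4 * β) + α < k)
    (q : ℤ) (hq : 0 ≤ q)
    (hlow : (q : ℝ) ^ 2 + 2 * α * q - α * β ≤ β * k)
    (hhigh : β * k < (q : ℝ) ^ 2 + 2 * α * q + α * β) :
    q = ⌊Real.sqrt (β * (k + α) + α ^ 2) - α⌋ := by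
  have hq' : (0 : ℝ) ≤ q := by exact_mod_cast hq
  have hk' : (2 * α * β - 1) ^ 2 < 4 * (β * (k - α) + α ^ 2) := by
    have h := lt_sub_iff_add_lt.2 hk
    rw [div_lt_iff₀ (by linarith)] at h
    linarith
  have hαβ : 1 ≤ 2 * α * β := by nlinarith
  have hx : 0 ≤ β * (k - α) + α ^ 2 := by nlinarith [sq_nonneg (2 * α * β - 1)]
  set s := Real.sqrt (β * (k - α) + α ^ 2) with hs
  have hs0 : 0 ≤ s := Real.sqrt_nonneg _
  have hss : s ^ 2 = β * (k - α) + α ^ 2 := Real.sq_sqrt hx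
  have hsl : 2 * α * β - 1 < 2 * s := by
    by_contra! h
    nlinarith
  have hsq : s < q + α := by
    by_contra! h
    nlinarith
  symm
  rw [Int.floor_eq_iff]
  constructor
  · rw [le_sub_iff_add_le]
    apply Real.le_sqrt_of_sq_le
    nlinarith
  · rw [sub_lt_iff_lt_add, Real.sqrt_lt' (by linarith)]
    nlinarith

theorem stmt_9 (a b c : ℕ)
    (ha : 0 < a) (hb : 0 < b) (hc : 0 < c)
    (habc : Nat.gcd (Nat.gcd a b) c = 1)
    (g1 g2 g3 : ℕ) (hg1 : g1 = Nat.gcd b c) (hg2 : g2 = Nat.gcd c a)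
    (hg3 : g3 = Nat.gcd a b)
    (A B C : ℕ) (hA : A = a / (g2 * g3)) (hB : B = b / (g3 * g1))
    (hC : C = c / (g1 * g2))
    (α β : ℝ) (hα : α = ((A : ℝ) + B + C) / 2) (hβ : β = 2 * A * B * C)
    (M : ℤ) (hM : M = ⌊((2 * α * β - 1) ^ 2 - 4 * α ^ 2) / (4 * β) + α⌋ + 1)
    (k : ℕ)
    (γ δ : ℤ)
    (hγ : γ = ⌊Real.sqrt (β * ((k : ℝ) + α) + α ^ 2) - α⌋)
    (hδ : δ = ⌊Real.sqrt (β * ((k : ℝ) - α) + α ^ 2) - α⌋)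
    (hk : M ≤ (k : ℤ)) (hγδ : γ ≠ δ)
    (hsol : {p : ℕ × ℕ × ℕ |
      (A : ℤ) * p.1 + (B : ℤ) * p.2.1 + (C : ℤ) * p.2.2 = γ}.ncard = k) :
    {t : ℕ | numSol a b c t = k} =
      {t : ℕ | ∃ i1 i2 i3 : ℕ, i1 ≤ g1 - 1 ∧ i2 ≤ g2 - 1 ∧ i3 ≤ g3 - 1 ∧
        (t : ℤ) = (g1 : ℤ) * g2 * g3 * γ + a * i1 + b * i2 + c * i3} := by
  obtain ⟨ea, ca, cAB⟩ := exists_gcd_decomposition a b c ha habc g1 g2 g3 hg1 hg2 hg3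
  obtain ⟨eb, cb, cBC⟩ := exists_gcd_decomposition b c a hb
    (by rw [Nat.gcd_comm, ← Nat.gcd_assoc]; exact habc) g2 g3 g1 hg2 hg3 hg1
  obtain ⟨ec, cc, cCA⟩ := exists_gcd_decomposition c a b hc
    (by rw [Nat.gcd_assoc, Nat.gcd_comm]; exact habc) g3 g1 g2 hg3 hg1 hg2
  have hg1pos : 0 < g1 := hg1 ▸ Nat.gcd_pos_of_pos_left _ hb
  have hg2pos : 0 < g2 := hg2 ▸ Nat.gcd_pos_of_pos_left _ hc
  have hg3pos : 0 < g3 := hg3 ▸ Nat.gcd_pos_of_pos_left _ ha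
  rw [← hA] at ea cAB cCA
  rw [← hB] at eb cAB cBC
  rw [← hC] at ec cBC cCA
  clear hA hB hC hg1 hg2 hg3
  subst ea eb ec
  have hA0 : 0 < A := Nat.pos_of_mul_pos_left ha
  have hB0 : 0 < B := Nat.pos_of_mul_pos_left hb
  have hC0 : 0 < C := Nat.pos_of_mul_pos_left hc
  have hA1 : (1 : ℝ) ≤ A := by exact_mod_cast hA0
  have hB1 : (1 : ℝ) ≤ B := by exact_mod_cast hB0
  have hC1 : (1 : ℝ) ≤ C := by exact_mod_cast hC0
  have hα1 : 3 ≤ 2 * α := by rw [hα]; linarith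
  have hβ2 : 2 ≤ β := by
    rw [hβ]
    nlinarith [mul_le_mul hA1 hB1 zero_le_one (by linarith : (0 : ℝ) ≤ A),
      mul_le_mul (mul_le_mul hA1 hB1 zero_le_one (by linarith)) hC1 zero_le_one
        (by positivity)]
  have hkM : ((2 * α * β - 1) ^ 2 - 4 * α ^ 2) / (4 * β) + α < (k : ℝ) := by
    have : ⌊((2 * α * β - 1) ^ 2 - 4 * α ^ 2) / (4 * β) + α⌋ < (k : ℤ) := by omega
    exact_mod_cast Int.floor_lt.1 this
  have hk0 : k ≠ 0 := by
    rintro rfl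
    have : 0 ≤ ((2 * α * β - 1) ^ 2 - 4 * α ^ 2) / (4 * β) := by
      apply div_nonneg _ (by linarith)
      have h : 2 * α ≤ 2 * α * β - 1 := by nlinarith
      nlinarith
    push_cast at hkM
    linarith
  have unique : ∀ q : ℤ, {p : ℕ × ℕ × ℕ |
      (A : ℤ) * p.1 + (B : ℤ) * p.2.1 + (C : ℤ) * p.2.2 = q}.ncard = k → q = γ := by
    intro q hq
    have hq0 : 0 ≤ q := by
      obtain ⟨p, hp⟩ := Set.nonempty_of_ncard_ne_zero (hq.trans_ne hk0)
      rw [← hp.out]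
      positivity
    obtain ⟨n, rfl⟩ := Int.eq_ofNat_of_zero_le hq0
    have hn : numSol A B C n = k := by
      rw [← hq, numSol]
      congr 1
      ext p
      exact_mod_cast Iff.rfl
    obtain ⟨l, u⟩ := numSol_bounds_s9 A B C hA0 hB0 hC0 cAB cBC cCA n
    rw [hn] at l u
    rw [hγ]
    refine eq_floor_of_bounds α β k (by linarith) (by linarith) hkM n hq0 ?_ ?_
    · have l' : (n ^ 2 + (A + B + C) * n - (A + B + C) * (A * B * C) : ℝ) ≤
        2 * (A * B * C) * k := by exact_mod_cast l
      rw [hα, hβ]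
      push_cast
      linarith
    · have u' : 2 * (A * B * C) * k <
        (n ^ 2 + (A + B + C) * n + (A + B + C) * (A * B * C) : ℝ) := by exact_mod_cast u
      rw [hα, hβ]
      push_cast
      linarith
  ext t
  simp only [Set.mem_ofPred_eq]
  constructor
  · intro ht
    obtain ⟨i1, i2, i3, q, h1, h2, h3, hq⟩ :=
      exists_residues A B C g1 g2 g3 hg1pos hg2pos hg3pos ca cb cc t
    rw [numSol_eq_ncard_reduced A B C g1 g2 g3 hg1pos hg2pos hg3pos ca cb cc t i1 i2 i3 q
      h1 h2 h3 hq] at ht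
    rw [unique q ht] at hq
    exact ⟨i1, i2, i3, by omega, by omega, by omega, hq⟩
  · rintro ⟨i1, i2, i3, h1, h2, h3, hq⟩
    rw [numSol_eq_ncard_reduced A B C g1 g2 g3 hg1pos hg2pos hg3pos ca cb cc t i1 i2 i3 γ
      (by omega) (by omega) (by omega) hq]
    exact hsol
end
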